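/- arXiv:1102.0439 — 3 statements merged into one kernel-verified Lean document; each statement's English description precedes it below -/
import Mathlib

section
/- Let |Ψ⟩_ABC be a tripartite pure state whose reduced state ρ_BC is PPT. Then the reduced state ρ_AB is separable if and only if it satisfies the reduction criterion ρ_A ⊗ I_B ≥ ρ_AB and I_A ⊗ ρ_B ≥ ρ_AB. -/
open Matrix BigOperators
open scoped ComplexOrder

noncomputable section

/-- A density matrix: positive semidefinite with trace one. -/
def IsDensity {α : Type*} [Fintype α] (ρ : Matrix α α ℂ) : Prop :=
  ρ.PosSemidef ∧ ρ.trace = 1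

/-- Tensor (Kronecker) product of matrices on a product index type. -/
def tens {α β : Type*} (σ : Matrix α α ℂ) (τ : Matrix β β ℂ) :
    Matrix (α × β) (α × β) ℂ :=
  fun p q => σ p.1 q.1 * τ p.2 q.2

/-- Separability: a finite convex combination of product density matrices. -/
def SeparableState {α β : Type*} [Fintype α] [Fintype β]
    (ρ : Matrix (α × β) (α × β) ℂ) : Prop :=
  ∃ (k : ℕ) (p : Fin k → ℝ) (σ : Fin k → Matrix α α ℂ) (τ : Fin k → Matrix β β ℂ),
    (∀ i, 0 ≤ p i) ∧ ∑ i, p i = 1 ∧ (∀ i, IsDensity (σ i)) ∧ (∀ i, IsDensity (τ i)) ∧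
    ρ = ∑ i, (p i : ℂ) • tens (σ i) (τ i)

/-- Partial transpose with respect to the second system. -/
def ptransB {α β : Type*} (ρ : Matrix (α × β) (α × β) ℂ) :
    Matrix (α × β) (α × β) ℂ :=
  fun p q => ρ (p.1, q.2) (q.1, p.2)

/-- Partial trace over the second system. -/
def ptrB {α β : Type*} [Fintype β] (ρ : Matrix (α × β) (α × β) ℂ) : Matrix α α ℂ :=
  fun i k => ∑ j, ρ (i, j) (k, j)

/-- Partial trace over the first system. -/
def ptrA {α β : Type*} [Fintype α] (ρ : Matrix (α × β) (α × β) ℂ) : Matrix β β ℂ :=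
  fun j l => ∑ i, ρ (i, j) (i, l)

/-- Rank-one projection |ψ⟩⟨ψ| associated with a vector. -/
def projv {α : Type*} (ψ : α → ℂ) : Matrix α α ℂ :=
  fun x y => ψ x * (starRingEnd ℂ) (ψ y)

/-- Unit vector condition. -/
def UnitVec {α : Type*} [Fintype α] (ψ : α → ℂ) : Prop :=
  ∑ x, Complex.normSq (ψ x) = 1

/-- Two-party reduced state ρ_АБ of a tripartite pure state. -/
def rhoAB {α β γ : Type*} [Fintype γ] (ψ : α × β × γ → ℂ) :
    Matrix (α × β) (α × β) ℂ :=
  fun p q => ∑ c, ψ (p.1, p.2, c) * (starRingEnd ℂ) (ψ (q.1, q.2, c))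

def rhoBC {α β γ : Type*} [Fintype α] (ψ : α × β × γ → ℂ) :
    Matrix (β × γ) (β × γ) ℂ :=
  fun p q => ∑ a, ψ (a, p.1, p.2) * (starRingEnd ℂ) (ψ (a, q.1, q.2))

def rhoAC {α β γ : Type*} [Fintype β] (ψ : α × β × γ → ℂ) :
    Matrix (α × γ) (α × γ) ℂ :=
  fun p q => ∑ b, ψ (p.1, b, p.2) * (starRingEnd ℂ) (ψ (q.1, b, q.2))

def rhoA {α β γ : Type*} [Fintype β] [Fintype γ] (ψ : α × β × γ → ℂ) :
    Matrix α α ℂ :=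
  fun x y => ∑ b, ∑ c, ψ (x, b, c) * (starRingEnd ℂ) (ψ (y, b, c))

def rhoB {α β γ : Type*} [Fintype α] [Fintype γ] (ψ : α × β × γ → ℂ) :
    Matrix β β ℂ :=
  fun x y => ∑ a, ∑ c, ψ (a, x, c) * (starRingEnd ℂ) (ψ (a, y, c))

def rhoC {α β γ : Type*} [Fintype α] [Fintype β] (ψ : α × β × γ → ℂ) :
    Matrix γ γ ℂ :=
  fun x y => ∑ a, ∑ b, ψ (a, b, x) * (starRingEnd ℂ) (ψ (a, b, y))

/-- `x` majorizes `y` (for nonnegative vectors, with implicit zero padding):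
the sum of any `|T|` entries of `y` is dominated by some choice of at most
`|T|` entries of `x`, and the total sums agree. -/
def Majorizes {α β : Type*} [Fintype α] [Fintype β] (x : α → ℝ) (y : β → ℝ) : Prop :=
  (∀ T : Finset β, ∃ S : Finset α, S.card ≤ T.card ∧ ∑ i ∈ T, y i ≤ ∑ i ∈ S, x i) ∧
  ∑ i, x i = ∑ i, y i

/-- Von Neumann entropy of a Hermitian matrix, via its eigenvalues. -/
def vN {α : Type*} [Fintype α] [DecidableEq α] {ρ : Matrix α α ℂ}
    (h : ρ.IsHermitian) : ℝ :=
  -∑ i, h.eigenvalues i * Real.log (h.eigenvalues i)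

/-- Tensor rank of a tripartite vector: least number of product vectors summing to it. -/
def tensorRank {α β γ : Type*} [Fintype α] [Fintype β] [Fintype γ]
    (ψ : α × β × γ → ℂ) : ℕ :=
  sInf {r : ℕ | ∃ (a : Fin r → α → ℂ) (b : Fin r → β → ℂ) (c : Fin r → γ → ℂ),
    ∀ x, ψ x = ∑ i, a i x.1 * b i x.2.1 * c i x.2.2}

/-- Orthonormal family of vectors. -/
def OrthonormalFam {α : Type*} [Fintype α] {k : ℕ} (v : Fin k → α → ℂ) : Prop :=
  ∀ i j, ∑ x, (starRingEnd ℂ) (v i x) * v j x = if i = j then 1 else 0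

/-- Maximally correlated state: ρ = Σ_{i,j} c_{ij} |i_B⟩⟨j_B| ⊗ |i_C⟩⟨j_C|
for some orthonormal families. -/
def IsMaxCorrelated {β γ : Type*} [Fintype β] [Fintype γ]
    (ρ : Matrix (β × γ) (β × γ) ℂ) : Prop :=
  ∃ (k : ℕ) (c : Matrix (Fin k) (Fin k) ℂ) (e : Fin k → β → ℂ) (f : Fin k → γ → ℂ),
    OrthonormalFam e ∧ OrthonormalFam f ∧
    ∀ p q, ρ p q = ∑ i, ∑ j,
      c i j * (e i p.1 * (starRingEnd ℂ) (e j q.1)) * (f i p.2 * (starRingEnd ℂ) (f j q.2))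

section BlockMatrix

variable {β γ : Type*}

/-- The matrix on a product index type with the given blocks. -/
def blockMat (F : β → β → Matrix γ γ ℂ) : Matrix (β × γ) (β × γ) ℂ :=
  fun p q => F p.1 q.1 p.2 q.2

/-- The matrices of a family stacked on top of each other. -/
def stackMat {α : Type*} (K : β → Matrix γ α ℂ) : Matrix (β × γ) α ℂ :=
  fun p x => K p.1 p.2 x

theorem blockMat_conjTranspose (F : β → β → Matrix γ γ ℂ) :
    (blockMat F)ᴴ = blockMat fun b b' => (F b' b)ᴴ := rfl

theorem blockMat_one [DecidableEq β] [DecidableEq γ] :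
    blockMat (fun b b' : β => if b = b' then (1 : Matrix γ γ ℂ) else 0) = 1 := by
  ext ⟨b, c⟩ ⟨b', c'⟩
  by_cases h : b = b' <;> simp [blockMat, h, Matrix.one_apply]

theorem stackMat_mul_conjTranspose {α : Type*} [Fintype α] (K : β → Matrix γ α ℂ) :
    stackMat K * (stackMat K)ᴴ = blockMat fun b b' => K b * (K b')ᴴ := by
  ext ⟨b, c⟩ ⟨b', c'⟩
  simp [blockMat, stackMat, Matrix.mul_apply]

variable [Fintype β] [Fintype γ]

theorem blockMat_mul (F G : β → β → Matrix γ γ ℂ) :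
    blockMat F * blockMat G = blockMat fun b b' => ∑ d, F b d * G d b' := by
  ext ⟨b, c⟩ ⟨b', c'⟩
  simp [blockMat, Matrix.mul_apply, Fintype.sum_prod_type, Matrix.sum_apply]

theorem trace_blockMat (F : β → β → Matrix γ γ ℂ) :
    (blockMat F).trace = ∑ b, (F b b).trace := by
  simp [blockMat, Matrix.trace, Fintype.sum_prod_type]

theorem stackMat_conjTranspose_mul {α : Type*} (K : β → Matrix γ α ℂ) :
    (stackMat K)ᴴ * stackMat K = ∑ b, (K b)ᴴ * K b := by
  ext x y
  simp [stackMat, Matrix.mul_apply, Fintype.sum_prod_type, Matrix.sum_apply]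

/-- A positive block matrix satisfies the reduction criterion after partial transposition. -/
theorem Matrix.PosSemidef.blockMat_reduction [DecidableEq β] {F : β → β → Matrix γ γ ℂ}
    (hF : (blockMat F).PosSemidef) :
    (blockMat fun b b' => (if b = b' then ∑ d, F d d else 0) - F b' b).PosSemidef := by
  classical
  let V (d b : β) : Matrix (β × γ) (β × γ) ℂ := blockMat fun x y =>
    (if x = d then (if y = b then (1 : Matrix γ γ ℂ) else 0) else 0) -
      (if x = b then (if y = d then 1 else 0) else 0)
  have hsum : (blockMat fun b b' => (if b = b' then ∑ d, F d d else 0) - F b' b) =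
      (1 / 2 : ℂ) • ∑ d, ∑ b, (V d b)ᴴ * blockMat F * V d b := by
    have key : ∑ d, ∑ b, (V d b)ᴴ * blockMat F * V d b = blockMat fun y y' =>
        ((if y = y' then ∑ d, F d d else 0) - F y' y) +
        ((if y = y' then ∑ d, F d d else 0) - F y' y) := by
      have hVc (d b : β) : (V d b)ᴴ = blockMat fun y x =>
          (if x = d then (if y = b then (1 : Matrix γ γ ℂ) else 0) else 0) -
            (if x = b then (if y = d then 1 else 0) else 0) := by
        rw [blockMat_conjTranspose]
        congr 1
        ext1 y
        ext1 x
        split_ifs <;> simp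
      have hV (d b : β) : (V d b)ᴴ * blockMat F * V d b = blockMat fun y y' =>
          (if y = b then (if y' = b then F d d else 0) else 0)
          - (if y = b then (if y' = d then F d b else 0) else 0)
          - (if y = d then (if y' = b then F b d else 0) else 0)
          + (if y = d then (if y' = d then F b b else 0) else 0) := by
        rw [hVc]
        simp only [V, blockMat_mul]
        congr 1
        ext1 y
        ext1 y'
        simp only [sub_mul, mul_sub, ite_mul, mul_ite, one_mul, mul_one, zero_mul,
          mul_zero, Finset.sum_sub_distrib, Finset.sum_ite_eq', Finset.mem_univ, if_true]
        split_ifs <;> abel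
      simp only [hV]
      ext ⟨y, c⟩ ⟨y', c'⟩
      simp only [blockMat, Matrix.sum_apply, Matrix.add_apply, Matrix.sub_apply, apply_ite
        (fun A : Matrix γ γ ℂ => A c c'), Matrix.zero_apply, Finset.sum_add_distrib,
        Finset.sum_sub_distrib, Finset.sum_ite_eq, Finset.mem_univ, if_true]
      by_cases h : y = y'
      · subst h
        simp [Finset.sum_ite_eq]
        ring
      · have h' : y' ≠ y := fun e => h e.symm
        simp [Finset.sum_ite_eq, h, h']
        ring
    rw [key]
    ext p q
    simp only [blockMat, Matrix.smul_apply, Matrix.add_apply, smul_eq_mul]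
    ring
  rw [hsum]
  refine PosSemidef.smul (posSemidef_sum _ fun d _ => posSemidef_sum _ fun b _ =>
    hF.conjTranspose_mul_mul_same _) ?_
  norm_num [Complex.le_def]

end BlockMatrix

section PosSemidef

theorem eq_zero_of_sum_trace_conjTranspose_mul_self {ι m n : Type*} [Fintype ι] [Fintype m]
    [Fintype n] {N : ι → Matrix m n ℂ} (h : ∑ i, ((N i)ᴴ * N i).trace = 0) (i : ι) : N i = 0 := by
  rw [Finset.sum_eq_zero_iff_of_nonneg
    fun i _ => (posSemidef_conjTranspose_mul_self (N i)).trace_nonneg] at h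
  exact trace_conjTranspose_mul_self_eq_zero_iff.mp (h i (Finset.mem_univ i))

theorem posSemidef_of_isHermitian_of_isIdempotent {n : Type*} [Fintype n] {P : Matrix n n ℂ}
    (hP : Pᴴ = P) (hPP : P * P = P) : P.PosSemidef := by
  have := posSemidef_conjTranspose_mul_self P
  rwa [hP, hPP] at this

theorem posSemidef_one_sub_of_isHermitian_of_isIdempotent {n : Type*} [Fintype n] [DecidableEq n]
    {P : Matrix n n ℂ} (hP : Pᴴ = P) (hPP : P * P = P) : (1 - P).PosSemidef :=
  posSemidef_of_isHermitian_of_isIdempotent (by simp [hP]) (by simp [mul_sub, sub_mul, hPP])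

theorem posSemidef_one_sub_conjTranspose_mul_self {m n : Type*} [Fintype m] [Fintype n]
    [DecidableEq m] [DecidableEq n] {K : Matrix m n ℂ} (h : (1 - K * Kᴴ).PosSemidef) :
    (1 - Kᴴ * K).PosSemidef := by
  have h₁ := posSemidef_conjTranspose_mul_self (1 - Kᴴ * K)
  have h₂ := h.conjTranspose_mul_mul_same K
  have : 1 - Kᴴ * K = (1 - Kᴴ * K)ᴴ * (1 - Kᴴ * K) + Kᴴ * (1 - K * Kᴴ) * K := by
    simp only [conjTranspose_sub, conjTranspose_one, conjTranspose_mul,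
      conjTranspose_conjTranspose, Matrix.mul_sub, Matrix.sub_mul, Matrix.mul_one,
      Matrix.one_mul, Matrix.mul_assoc]
    abel
  rw [this]
  exact h₁.add h₂

theorem Matrix.PosSemidef.exists_conjTranspose_mul_self {n : Type*} [Fintype n]
    {T : Matrix n n ℂ} (h : T.PosSemidef) : ∃ Z : Matrix n n ℂ, T = Zᴴ * Z := by
  classical
  open scoped MatrixOrder in
  exact (CStarAlgebra.nonneg_iff_eq_star_mul_self).mp h.nonneg

theorem Matrix.PosSemidef.mul_self_eq_of_trace {n : Type*} [Fintype n] [DecidableEq n]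
    {T : Matrix n n ℂ} (h₀ : T.PosSemidef) (h₁ : (1 - T).PosSemidef)
    (ht : (T * T).trace = T.trace) : T * T = T := by
  obtain ⟨Z, hZ⟩ := h₀.exists_conjTranspose_mul_self
  obtain ⟨Y, hY⟩ := h₁.exists_conjTranspose_mul_self
  have h : ((Y * Zᴴ)ᴴ * (Y * Zᴴ)).trace = 0 := by
    have e : (Y * Zᴴ)ᴴ * (Y * Zᴴ) = Z * ((1 - T) * Zᴴ) := by
      rw [hY]; simp [Matrix.mul_assoc]
    rw [e, Matrix.trace_mul_comm, Matrix.mul_assoc, ← hZ, sub_mul, one_mul, trace_sub, ht, sub_self]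
  rw [trace_conjTranspose_mul_self_eq_zero_iff] at h
  have : (1 - T) * T = 0 := by
    rw [hY, hZ, Matrix.mul_assoc, ← Matrix.mul_assoc Y, h]; simp
  rw [sub_mul, one_mul, sub_eq_zero] at this
  exact this.symm

theorem Matrix.PosSemidef.posSemidef_one_sub_of_trace_eq_one {n : Type*} [Fintype n]
    [DecidableEq n] {T : Matrix n n ℂ} (h : T.PosSemidef) (ht : T.trace = 1) :
    (1 - T).PosSemidef := by
  have hF : (blockMat fun b b' : n => (of fun _ _ => T b b' : Matrix Unit Unit ℂ)).PosSemidef :=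
    h.submatrix Prod.fst
  have h₁ := (hF.blockMat_reduction.submatrix fun b : n => (b, ())).transpose
  have h₂ : 1 - T = ((blockMat fun b b' : n => (if b = b' then
      ∑ d, (of fun _ _ => T d d : Matrix Unit Unit ℂ) else 0) - of fun _ _ => T b' b).submatrix
        (fun b => (b, ())) fun b => (b, ()))ᵀ := by
    ext b b'
    by_cases e : b = b'
    · subst e
      simp [blockMat, Matrix.sum_apply, ← ht, Matrix.trace]
    · have e' : b' ≠ b := fun e' => e e'.symm
      simp [blockMat, e, e']
  rwa [h₂]

end PosSemidef

section InvSqrt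

/-- `S` is the square root of the pseudo-inverse of `R`, and `P` the projection onto the
range of `R`. -/
structure IsInvSqrt {n : Type*} [Fintype n] (R S P : Matrix n n ℂ) : Prop where
  conjTranspose_eq : Sᴴ = S
  mul_mul_self : S * R * S = P
  proj_conjTranspose : Pᴴ = P
  proj_mul : P * S = S
  proj_mul_self : P * R = R

theorem Matrix.PosSemidef.exists_isInvSqrt {n : Type*} [Fintype n] {R : Matrix n n ℂ}
    (hR : R.PosSemidef) : ∃ S P, IsInvSqrt R S P := by
  classical
  set U : Matrix n n ℂ := hR.1.eigenvectorUnitary.1 with hU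
  have hUU : Uᴴ * U = 1 := Unitary.coe_star_mul_self hR.1.eigenvectorUnitary
  set v : n → ℝ := hR.1.eigenvalues with hv
  have hv0 : ∀ i, 0 ≤ v i := hR.eigenvalues_nonneg
  have hRU : R = U * diagonal (fun i => (v i : ℂ)) * Uᴴ := by
    conv_lhs => rw [hR.1.spectral_theorem]
    rfl
  have mulU (f g : n → ℂ) : (U * diagonal f * Uᴴ) * (U * diagonal g * Uᴴ) =
      U * diagonal (fun i => f i * g i) * Uᴴ := by
    calc _ = U * diagonal f * (Uᴴ * U) * diagonal g * Uᴴ := by simp only [Matrix.mul_assoc]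
      _ = _ := by rw [hUU, Matrix.mul_one, Matrix.mul_assoc U, diagonal_mul_diagonal]
  have ctU (f : n → ℝ) : (U * diagonal (fun i => (f i : ℂ)) * Uᴴ)ᴴ =
      U * diagonal (fun i => (f i : ℂ)) * Uᴴ := by
    simp only [conjTranspose_mul, conjTranspose_conjTranspose, diagonal_conjTranspose,
      Matrix.mul_assoc]
    congr 3
    ext i
    simp
  refine ⟨U * diagonal (fun i => (((√(v i))⁻¹ : ℝ) : ℂ)) * Uᴴ,
    U * diagonal (fun i => ((if v i = 0 then 0 else 1 : ℝ) : ℂ)) * Uᴴ, ctU _, ?_, ctU _, ?_, ?_⟩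
  all_goals
    try rw [hRU]
    simp only [mulU]
    congr 3
    ext i
    simp only [← Complex.ofReal_mul, Complex.ofReal_inj]
    by_cases h : v i = 0
    · simp [h]
    · have := Real.mul_self_sqrt (hv0 i)
      have h' : √(v i) ≠ 0 := fun e => h (by rw [← this, e, zero_mul])
      simp only [h, if_false]
      field_simp
      try rw [sq, this]

variable {n : Type*} [Fintype n] {R S P : Matrix n n ℂ}

namespace IsInvSqrt

theorem proj_mul_proj (h : IsInvSqrt R S P) : P * P = P := by
  nth_rw 2 [← h.mul_mul_self]
  rw [← Matrix.mul_assoc, ← Matrix.mul_assoc, h.proj_mul, h.mul_mul_self]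

theorem proj_mul_of_sum {ι m : Type*} [Fintype ι] [Fintype m] {M : ι → Matrix n m ℂ}
    (h : IsInvSqrt (∑ i, M i * (M i)ᴴ) S P) (i : ι) : P * M i = M i := by
  classical
  have hz : ∑ i, (((1 - P) * M i)ᴴ * ((1 - P) * M i)).trace = 0 := by
    have (i : ι) : (((1 - P) * M i)ᴴ * ((1 - P) * M i)).trace =
        ((1 - P) * (M i * (M i)ᴴ) * (1 - P)).trace := by
      rw [Matrix.trace_mul_comm, conjTranspose_mul, conjTranspose_sub, conjTranspose_one,
        h.proj_conjTranspose]
      simp only [Matrix.mul_assoc]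
    simp only [this]
    rw [← trace_sum, ← Finset.sum_mul, ← Finset.mul_sum, sub_mul 1 P, h.proj_mul_self]
    simp
  have := eq_zero_of_sum_trace_conjTranspose_mul_self hz i
  rw [Matrix.sub_mul, Matrix.one_mul, sub_eq_zero] at this
  exact this.symm

end IsInvSqrt

end InvSqrt

section Commuting

variable {α β γ : Type*} [Fintype α] [Fintype β] [Fintype γ]

variable {M : β → Matrix γ α ℂ} {S P : Matrix γ γ ℂ} {P' : Matrix α α ℂ}

namespace IsInvSqrt

theorem sum_mul_conjTranspose (h : IsInvSqrt (∑ b, M b * (M b)ᴴ) S P) :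
    ∑ b, (S * M b) * (S * M b)ᴴ = P := by
  rw [← h.mul_mul_self, Finset.mul_sum, Finset.sum_mul]
  simp [h.conjTranspose_eq, Matrix.mul_assoc]

theorem trace_sum_conjTranspose_mul (h : IsInvSqrt (∑ b, M b * (M b)ᴴ) S P) :
    (∑ b, (S * M b)ᴴ * (S * M b)).trace = P.trace := by
  rw [← h.sum_mul_conjTranspose, trace_sum, trace_sum]
  exact Finset.sum_congr rfl fun b _ => Matrix.trace_mul_comm _ _

theorem sum_trace_intertwine (h : IsInvSqrt (∑ b, M b * (M b)ᴴ) S P)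
    (hP' : P' * ∑ b, (M b)ᴴ * M b = ∑ b, (M b)ᴴ * M b)
    (hK : ∑ b, (S * M b)ᴴ * (S * M b) = P') :
    ∑ b, ((S * M b * (∑ d, (M d)ᴴ * M d) - (∑ d, M d * (M d)ᴴ) * (S * M b))ᴴ *
      (S * M b * (∑ d, (M d)ᴴ * M d) - (∑ d, M d * (M d)ᴴ) * (S * M b))).trace =
    ((∑ d, M d * (M d)ᴴ) * ∑ d, M d * (M d)ᴴ).trace -
      ((∑ d, (M d)ᴴ * M d) * ∑ d, (M d)ᴴ * M d).trace := by
  have hPM := h.proj_mul_of_sum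
  have hKK := h.sum_mul_conjTranspose
  have hSRS := h.mul_mul_self
  have hPR := h.proj_mul_self
  set Q := ∑ d, (M d)ᴴ * M d with hQ
  set R := ∑ d, M d * (M d)ᴴ with hR
  have hRh : Rᴴ = R := by simp [hR, conjTranspose_sum]
  have hQh : Qᴴ = Q := by simp [hQ, conjTranspose_sum]
  have hKRK : ∑ b, (S * M b)ᴴ * R * (S * M b) = Q := by
    refine Finset.sum_congr rfl fun b _ => ?_
    calc (S * M b)ᴴ * R * (S * M b) = (M b)ᴴ * (S * R * S * M b) := by
          simp [Matrix.mul_assoc, h.conjTranspose_eq]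
      _ = _ := by rw [hSRS, hPM]
  have hexp (b : β) : (S * M b * Q - R * (S * M b))ᴴ * (S * M b * Q - R * (S * M b)) =
      Q * ((S * M b)ᴴ * (S * M b)) * Q - Q * ((S * M b)ᴴ * R * (S * M b))
      - ((S * M b)ᴴ * R * (S * M b)) * Q + (S * M b)ᴴ * (R * R * (S * M b)) := by
    simp only [conjTranspose_sub, conjTranspose_mul, hRh, hQh, Matrix.sub_mul, Matrix.mul_sub,
      Matrix.mul_assoc]
    abel
  have hlast : ∑ b, ((S * M b)ᴴ * (R * R * (S * M b))).trace = (R * R).trace := by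
    simp_rw [fun b => Matrix.trace_mul_comm ((S * M b)ᴴ) (R * R * (S * M b)),
      fun b => Matrix.mul_assoc (R * R) (S * M b) ((S * M b)ᴴ)]
    rw [← trace_sum, ← Finset.mul_sum, hKK, Matrix.trace_mul_comm, ← Matrix.mul_assoc, hPR]
  rw [← trace_sum]
  simp_rw [hexp]
  rw [Finset.sum_add_distrib, Finset.sum_sub_distrib, Finset.sum_sub_distrib, ← Finset.sum_mul,
    ← Finset.mul_sum, ← Finset.mul_sum, ← Finset.sum_mul, hK, hKRK, trace_add, trace_sum, hlast,
    Matrix.mul_assoc, hP', trace_sub, trace_sub]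
  ring

end IsInvSqrt

theorem blockMat_diagonal_conjTranspose {β γ : Type*} [DecidableEq β] (S : Matrix γ γ ℂ) :
    (blockMat fun b b' : β => if b = b' then S else 0)ᴴ =
      blockMat fun b b' => if b = b' then Sᴴ else 0 := by
  rw [blockMat_conjTranspose]
  congr 1
  ext1 b
  ext1 b'
  by_cases h : b = b'
  · simp [h]
  · simp [h, Ne.symm h]

theorem sum_mul_conjTranspose_mul_mul {n : Type*} {K : β → Matrix γ α ℂ}
    (hKP : ∀ b, K b * P' = K b) (hKK' : ∑ b, (K b)ᴴ * K b = P') (b : β) (X : Matrix α n ℂ) :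
    ∑ d, K b * ((K d)ᴴ * (K d * X)) = K b * X := by
  simp_rw [← Matrix.mul_assoc (_ᴴ)]
  rw [← Matrix.mul_sum, ← Matrix.sum_mul, hKK', ← Matrix.mul_assoc, hKP]

variable [DecidableEq β]

theorem Matrix.PosSemidef.blockMat_diagonal {X : Matrix γ γ ℂ} (hX : X.PosSemidef) :
    (blockMat fun b b' : β => if b = b' then X else 0).PosSemidef := by
  obtain ⟨Z, rfl⟩ := hX.exists_conjTranspose_mul_self
  convert! posSemidef_conjTranspose_mul_self (blockMat fun b b' : β => if b = b' then Z else 0)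
    using 1
  simp [blockMat_diagonal_conjTranspose, blockMat_mul]

theorem blockMat_diagonal_conj (S : Matrix γ γ ℂ) (F : β → β → Matrix γ γ ℂ) :
    (blockMat fun b b' : β => if b = b' then S else 0) * blockMat F *
      (blockMat fun b b' : β => if b = b' then S else 0) =
    blockMat fun b b' => S * F b b' * S := by
  simp [blockMat_mul]

theorem Matrix.PosSemidef.blockMat_conj {S : Matrix γ γ ℂ} (hS : Sᴴ = S)
    {F : β → β → Matrix γ γ ℂ} (hF : (blockMat F).PosSemidef) :
    (blockMat fun b b' => S * F b b' * S).PosSemidef := by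
  have := hF.conjTranspose_mul_mul_same (blockMat fun b b' : β => if b = b' then S else 0)
  rwa [blockMat_diagonal_conjTranspose, hS, blockMat_diagonal_conj] at this

namespace IsInvSqrt

theorem posSemidef_proj_sub (h : IsInvSqrt (∑ b, M b * (M b)ᴴ) S P)
    (hP' : P'ᴴ = P') (hPP' : P' * P' = P') (hM : ∀ b, M b * P' = M b)
    (hred : (blockMat fun b b' => (if b = b' then ∑ d, M d * (M d)ᴴ else 0) -
      M b * (M b')ᴴ).PosSemidef) :
    (P' - ∑ b, (S * M b)ᴴ * (S * M b)).PosSemidef := by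
  classical
  set K : β → Matrix γ α ℂ := fun b => S * M b with hK
  have h₁ := (hred.blockMat_conj h.conjTranspose_eq).add
    (posSemidef_one_sub_of_isHermitian_of_isIdempotent h.proj_conjTranspose
      h.proj_mul_proj).blockMat_diagonal
  have h₂ : 1 - stackMat K * (stackMat K)ᴴ = (blockMat fun b b' =>
      S * ((if b = b' then ∑ d, M d * (M d)ᴴ else 0) - M b * (M b')ᴴ) * S) +
      blockMat fun b b' => if b = b' then 1 - P else 0 := by
    rw [← blockMat_one, stackMat_mul_conjTranspose]
    ext ⟨b, c⟩ ⟨b', c'⟩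
    change ((if b = b' then 1 else 0 : Matrix γ γ ℂ) - K b * (K b')ᴴ) c c' =
      (S * ((if b = b' then ∑ d, M d * (M d)ᴴ else 0) - M b * (M b')ᴴ) * S +
        (if b = b' then 1 - P else 0)) c c'
    refine congrFun (congrFun ?_ c) c'
    simp only [hK, conjTranspose_mul, h.conjTranspose_eq, Matrix.mul_sub, Matrix.sub_mul]
    split_ifs
    · rw [h.mul_mul_self]; simp only [Matrix.mul_assoc]; abel
    · simp [Matrix.mul_assoc]; rfl
  rw [← h₂] at h₁
  have h₃ := (posSemidef_one_sub_conjTranspose_mul_self h₁).conjTranspose_mul_mul_same P'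
  convert h₃ using 1
  rw [stackMat_conjTranspose_mul, hP', Matrix.mul_sub, Matrix.sub_mul, Matrix.mul_one, hPP',
    Finset.mul_sum, Finset.sum_mul]
  congr 1
  refine Finset.sum_congr rfl fun b _ => ?_
  have e : K b * P' = K b := by rw [hK, Matrix.mul_assoc, hM]
  have e' : P' * (K b)ᴴ = (K b)ᴴ := by
    have := congrArg conjTranspose e
    rwa [conjTranspose_mul, hP'] at this
  change _ = P' * ((K b)ᴴ * K b) * P'
  rw [Matrix.mul_assoc, Matrix.mul_assoc, e, ← Matrix.mul_assoc P', e']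

end IsInvSqrt

/-- Rigidity of a family of matrices that is, up to support projections, both a trace-preserving
and a unital Kraus family and whose Choi-type block matrix is positive after partial
transposition. -/
theorem mul_conjTranspose_mul_comm_of_posSemidef {K : β → Matrix γ α ℂ}
    (hP : Pᴴ = P) (hPP : P * P = P) (hPK : ∀ b, P * K b = K b) (hKP : ∀ b, K b * P' = K b)
    (hKK : ∑ b, K b * (K b)ᴴ = P) (hKK' : ∑ b, (K b)ᴴ * K b = P')
    (hT : (blockMat fun b b' => K b' * (K b)ᴴ).PosSemidef) (d b b' : β) :
    K d * (K b)ᴴ * K b' = K b' * (K b)ᴴ * K d := by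
  classical
  have htr : P'.trace = P.trace := by
    rw [← hKK, ← hKK', trace_sum, trace_sum]
    exact Finset.sum_congr rfl fun b _ => Matrix.trace_mul_comm _ _
  have hT1 : (1 - blockMat fun b b' => K b' * (K b)ᴴ).PosSemidef := by
    have h₁ : (blockMat fun b b' => K b * (K b')ᴴ).PosSemidef := by
      rw [← stackMat_mul_conjTranspose]
      exact posSemidef_self_mul_conjTranspose _
    have h₂ := h₁.blockMat_reduction.add
      (posSemidef_one_sub_of_isHermitian_of_isIdempotent hP hPP).blockMat_diagonal
    convert! h₂ using 1
    rw [hKK, ← blockMat_one]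
    ext ⟨b, c⟩ ⟨b', c'⟩
    change ((if b = b' then 1 else 0 : Matrix γ γ ℂ) - K b' * (K b)ᴴ) c c' =
      ((if b = b' then P else 0) - K b' * (K b)ᴴ + (if b = b' then 1 - P else 0)) c c'
    refine congrFun (congrFun ?_ c) c'
    split_ifs <;> abel
  have hTT := hT.mul_self_eq_of_trace hT1 (by
    rw [blockMat_mul, trace_blockMat, trace_blockMat]
    simp only [trace_sum]
    rw [Finset.sum_comm]
    refine Finset.sum_congr rfl fun d _ => ?_
    rw [← trace_sum]
    congr 1
    rw [← sum_mul_conjTranspose_mul_mul hKP hKK' d]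
    simp only [Matrix.mul_assoc])
  have hE (b b' : β) : ∑ d, K d * (K b)ᴴ * (K b' * (K d)ᴴ) = K b' * (K b)ᴴ := by
    rw [blockMat_mul] at hTT
    ext c c'
    exact congrFun (congrFun hTT (b, c)) (b', c')
  have hAA : ∑ d, ∑ b, ∑ b', ((K d * (K b)ᴴ * K b')ᴴ * (K d * (K b)ᴴ * K b')).trace
      = P.trace := by
    rw [Finset.sum_comm]
    have h₁ (b : β) : ∑ d, ∑ b', ((K d * (K b)ᴴ * K b')ᴴ * (K d * (K b)ᴴ * K b')).trace =
        ∑ b', ((K b')ᴴ * (K b * (K b)ᴴ) * K b').trace := by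
      rw [Finset.sum_comm]
      refine Finset.sum_congr rfl fun b' _ => ?_
      rw [← trace_sum, Matrix.mul_assoc _ _ (K b'), Matrix.mul_assoc (K b),
        ← sum_mul_conjTranspose_mul_mul hKP hKK' b, Matrix.mul_sum]
      simp [Matrix.mul_assoc]
    simp_rw [h₁]
    rw [Finset.sum_comm, ← htr, ← hKK', trace_sum]
    refine Finset.sum_congr rfl fun b' _ => ?_
    rw [← trace_sum, ← Matrix.sum_mul, ← Matrix.mul_sum, hKK, Matrix.mul_assoc, hPK]
  have hAB : ∑ d, ∑ b, ∑ b', ((K d * (K b)ᴴ * K b')ᴴ * (K b' * (K b)ᴴ * K d)).trace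
      = P.trace := by
    rw [Finset.sum_comm]
    have h₁ (b : β) : ∑ d, ∑ b', ((K d * (K b)ᴴ * K b')ᴴ * (K b' * (K b)ᴴ * K d)).trace =
        (K b * (K b)ᴴ).trace := by
      rw [Finset.sum_comm]
      have h₂ (b' : β) : ∑ d, ((K d * (K b)ᴴ * K b')ᴴ * (K b' * (K b)ᴴ * K d)).trace =
          (K b * ((K b')ᴴ * K b') * (K b)ᴴ).trace := by
        have h₃ (d : β) : ((K d * (K b)ᴴ * K b')ᴴ * (K b' * (K b)ᴴ * K d)).trace =
            (K d * (K b')ᴴ * (K b * (K d)ᴴ) * (K b' * (K b)ᴴ)).trace := by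
          rw [← Matrix.mul_assoc, Matrix.trace_mul_comm]
          simp [Matrix.mul_assoc]
        simp_rw [h₃]
        rw [← trace_sum, ← Finset.sum_mul, hE]
        simp only [Matrix.mul_assoc]
      simp_rw [h₂, Matrix.mul_assoc]
      rw [← trace_sum, sum_mul_conjTranspose_mul_mul hKP hKK' b]
    simp_rw [h₁]
    rw [← trace_sum, hKK]
  have hswap (f : β → β → β → ℂ) : ∑ d, ∑ b, ∑ b', f d b b' = ∑ d, ∑ b, ∑ b', f b' b d := by
    rw [Finset.sum_comm]
    conv_rhs => rw [Finset.sum_comm]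
    exact Finset.sum_congr rfl fun b _ => Finset.sum_comm
  have hzero : ∑ x : β × β × β,
      ((K x.1 * (K x.2.1)ᴴ * K x.2.2 - K x.2.2 * (K x.2.1)ᴴ * K x.1)ᴴ *
        (K x.1 * (K x.2.1)ᴴ * K x.2.2 - K x.2.2 * (K x.2.1)ᴴ * K x.1)).trace = 0 := by
    simp only [Fintype.sum_prod_type]
    simp_rw [conjTranspose_sub, Matrix.sub_mul, Matrix.mul_sub, trace_sub,
      Finset.sum_sub_distrib]
    rw [hAA, hAB, hswap fun d b b' => ((K b' * (K b)ᴴ * K d)ᴴ * (K d * (K b)ᴴ * K b')).trace,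
      hswap fun d b b' => ((K b' * (K b)ᴴ * K d)ᴴ * (K b' * (K b)ᴴ * K d)).trace, hAA, hAB]
    ring
  have := eq_zero_of_sum_trace_conjTranspose_mul_self hzero (d, b, b')
  exact sub_eq_zero.mp this

theorem commute_conjTranspose_mul_of_reduction_of_ppt
    (hred : (blockMat fun b b' => (if b = b' then ∑ d, (M d)ᴴ * M d else 0) -
      (M b)ᴴ * M b').PosSemidef)
    (hppt : (blockMat fun b b' => M b' * (M b)ᴴ).PosSemidef) (b b' d d' : β) :
    Commute ((M b)ᴴ * M b') ((M d)ᴴ * M d') := by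
  classical
  have hRpos : (∑ b, M b * (M b)ᴴ).PosSemidef :=
    posSemidef_sum _ fun b _ => posSemidef_self_mul_conjTranspose _
  have hQpos : (∑ b, (M b)ᴴ * ((M b)ᴴ)ᴴ).PosSemidef :=
    posSemidef_sum _ fun b _ => posSemidef_self_mul_conjTranspose _
  obtain ⟨S, P, h⟩ := hRpos.exists_isInvSqrt
  obtain ⟨S', P', h'⟩ := hQpos.exists_isInvSqrt
  have hMP (b : β) : M b * P' = M b := by
    have := congrArg conjTranspose (h'.proj_mul_of_sum b)
    rwa [conjTranspose_mul, h'.proj_conjTranspose, conjTranspose_conjTranspose] at this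
  have hPM := h.proj_mul_of_sum
  have hD := h.posSemidef_proj_sub h'.proj_conjTranspose h'.proj_mul_proj hMP
    hppt.blockMat_reduction
  have hD' := h'.posSemidef_proj_sub h.proj_conjTranspose h.proj_mul_proj
    (fun b => by
      have := congrArg conjTranspose (hPM b)
      rwa [conjTranspose_mul, h.proj_conjTranspose] at this)
    (by simpa only [conjTranspose_conjTranspose] using hred)
  have ht := hD.trace_nonneg
  have ht' := hD'.trace_nonneg
  rw [trace_sub, h.trace_sum_conjTranspose_mul, sub_nonneg] at ht
  rw [trace_sub, h'.trace_sum_conjTranspose_mul, sub_nonneg] at ht'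
  have htr := le_antisymm ht ht'
  have hK : ∑ b, (S * M b)ᴴ * (S * M b) = P' := by
    refine (sub_eq_zero.mp (hD.trace_eq_zero_iff.mp ?_)).symm
    rw [trace_sub, h.trace_sum_conjTranspose_mul, htr, sub_self]
  have hK' : ∑ b, (S' * (M b)ᴴ)ᴴ * (S' * (M b)ᴴ) = P := by
    refine (sub_eq_zero.mp (hD'.trace_eq_zero_iff.mp ?_)).symm
    rw [trace_sub, h'.trace_sum_conjTranspose_mul, htr, sub_self]
  have hPQ := h'.proj_mul_self
  have hI := h.sum_trace_intertwine (by simpa only [conjTranspose_conjTranspose] using hPQ) hK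
  have hI' := h'.sum_trace_intertwine
    (by simpa only [conjTranspose_conjTranspose] using h.proj_mul_self) hK'
  have hnonneg := Finset.sum_nonneg fun b (_ : b ∈ Finset.univ) =>
    (posSemidef_conjTranspose_mul_self (S * M b * (∑ d, (M d)ᴴ * M d) -
      (∑ d, M d * (M d)ᴴ) * (S * M b))).trace_nonneg
  have hnonneg' := Finset.sum_nonneg fun b (_ : b ∈ Finset.univ) =>
    (posSemidef_conjTranspose_mul_self (S' * (M b)ᴴ * (∑ d, ((M d)ᴴ)ᴴ * (M d)ᴴ) -
      (∑ d, (M d)ᴴ * ((M d)ᴴ)ᴴ) * (S' * (M b)ᴴ))).trace_nonneg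
  rw [hI, sub_nonneg] at hnonneg
  rw [hI', sub_nonneg] at hnonneg'
  simp only [conjTranspose_conjTranspose] at hnonneg'
  rw [le_antisymm hnonneg hnonneg', sub_self] at hI
  have hint (b : β) : S * M b * (∑ d, (M d)ᴴ * M d) = (∑ d, M d * (M d)ᴴ) * (S * M b) :=
    sub_eq_zero.mp (eq_zero_of_sum_trace_conjTranspose_mul_self hI b)
  have hcomm := mul_conjTranspose_mul_comm_of_posSemidef (K := fun b => S * M b)
    h.proj_conjTranspose h.proj_mul_proj (fun b => by rw [← Matrix.mul_assoc, h.proj_mul])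
    (fun b => by rw [Matrix.mul_assoc, hMP]) h.sum_mul_conjTranspose hK
    (by simpa [h.conjTranspose_eq, Matrix.mul_assoc] using hppt.blockMat_conj h.conjTranspose_eq)
  have hSRS := h.mul_mul_self
  have hSh := h.conjTranspose_eq
  have hQh : (∑ d, (M d)ᴴ * M d)ᴴ = ∑ d, (M d)ᴴ * M d := by simp [conjTranspose_sum]
  have hRh : (∑ d, M d * (M d)ᴴ)ᴴ = ∑ d, M d * (M d)ᴴ := by simp [conjTranspose_sum]
  set Q := ∑ d, (M d)ᴴ * M d
  set R := ∑ d, M d * (M d)ᴴ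
  obtain ⟨K, hKdef⟩ : ∃ K : β → Matrix γ α ℂ, ∀ b, S * M b = K b := ⟨_, fun _ => rfl⟩
  simp only [hKdef] at hint hcomm
  have hint' (b : β) : Q * (K b)ᴴ = (K b)ᴴ * R := by
    have := congrArg conjTranspose (hint b)
    rwa [conjTranspose_mul, conjTranspose_mul, hQh, hRh] at this
  have hX (b b' : β) : (M b)ᴴ * M b' = (K b)ᴴ * K b' * Q := by
    calc (M b)ᴴ * M b' = (M b)ᴴ * (S * R * S * M b') := by rw [hSRS, hPM]
      _ = (K b)ᴴ * (R * K b') := by simp [← hKdef, hSh, Matrix.mul_assoc]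
      _ = _ := by rw [← hint, Matrix.mul_assoc]
  have hXQ (b b' : β) : Q * ((K b)ᴴ * K b') = (K b)ᴴ * K b' * Q := by
    rw [← Matrix.mul_assoc, hint', Matrix.mul_assoc, Matrix.mul_assoc, hint]
  have hcomm' (d b b' : β) : (K d)ᴴ * K b * (K b')ᴴ = (K b')ᴴ * K b * (K d)ᴴ := by
    have := congrArg conjTranspose (hcomm d b b').symm
    simpa only [conjTranspose_mul, conjTranspose_conjTranspose, Matrix.mul_assoc] using this
  have hXX : (K b)ᴴ * K b' * ((K d)ᴴ * K d') = (K d)ᴴ * K d' * ((K b)ᴴ * K b') := by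
    calc _ = (K b)ᴴ * (K b' * (K d)ᴴ * K d') := by simp only [Matrix.mul_assoc]
      _ = (K b)ᴴ * K d' * (K d)ᴴ * K b' := by rw [hcomm]; simp only [Matrix.mul_assoc]
      _ = _ := by rw [hcomm']; simp only [Matrix.mul_assoc]
  rw [hX, hX]
  change (K b)ᴴ * K b' * Q * ((K d)ᴴ * K d' * Q) = (K d)ᴴ * K d' * Q * ((K b)ᴴ * K b' * Q)
  calc _ = (K b)ᴴ * K b' * (Q * ((K d)ᴴ * K d')) * Q := by simp only [Matrix.mul_assoc]
    _ = (K b)ᴴ * K b' * ((K d)ᴴ * K d') * Q * Q := by rw [hXQ]; simp only [Matrix.mul_assoc]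
    _ = (K d)ᴴ * K d' * (Q * ((K b)ᴴ * K b')) * Q := by
      rw [hXX, hXQ]; simp only [Matrix.mul_assoc]
    _ = _ := by simp only [Matrix.mul_assoc]

end Commuting

section Diagonalization

variable {ι n : Type*} [Fintype n] [DecidableEq n] {A : ι → Matrix n n ℂ}

theorem exists_orthonormalBasis_joint_eigenvectors {E : Type*} [NormedAddCommGroup E]
    [InnerProductSpace ℂ E] [FiniteDimensional ℂ E] {T : ι → E →ₗ[ℂ] E}
    (hT : ∀ i, (T i).IsSymmetric) (hcomm : ∀ i j, Commute (T i) (T j)) :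
    ∃ (u : OrthonormalBasis (Fin (Module.finrank ℂ E)) ℂ E)
      (χ : Fin (Module.finrank ℂ E) → ι → ℂ), ∀ i x, T i (u x) = χ x i • u x := by
  classical
  set V : (ι → ℂ) → Submodule ℂ E := fun χ => ⨅ i, Module.End.eigenspace (T i) (χ i) with hV
  have hint : DirectSum.IsInternal V :=
    LinearMap.IsSymmetric.directSum_isInternal_of_pairwise_commute hT fun i j _ => hcomm i j
  have horth := LinearMap.IsSymmetric.orthogonalFamily_iInf_eigenspaces hT
  have hfin : Finite {χ // V χ ≠ ⊥} :=
    WellFoundedGT.finite_ne_bot_of_iSupIndep hint.submodule_iSupIndep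
  have := Fintype.ofFinite {χ // V χ ≠ ⊥}
  have hint' := DirectSum.isInternal_ne_bot_iff.mpr hint
  have horth' : OrthogonalFamily ℂ (fun χ : {χ // V χ ≠ ⊥} => V χ)
      fun χ => (V χ).subtypeₗᵢ := horth.comp Subtype.val_injective
  refine ⟨hint'.subordinateOrthonormalBasis rfl horth',
    fun x => (hint'.subordinateOrthonormalBasisIndex rfl x horth').1, fun i x => ?_⟩
  have hmem := hint'.subordinateOrthonormalBasis_subordinate rfl x horth'
  exact Module.End.mem_eigenspace_iff.mp ((Submodule.mem_iInf _).mp hmem i)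

theorem exists_joint_diagonalization_of_isHermitian (hA : ∀ i, (A i).IsHermitian)
    (hcomm : ∀ i j, Commute (A i) (A j)) :
    ∃ U : Matrix n n ℂ, Uᴴ * U = 1 ∧ ∀ i, ∃ f : n → ℂ, A i = U * diagonal f * Uᴴ := by
  have hn : Module.finrank ℂ (EuclideanSpace ℂ n) = Fintype.card n := by simp
  obtain ⟨u, χ, hu⟩ := exists_orthonormalBasis_joint_eigenvectors
    (T := fun i => Matrix.toEuclideanLin (A i))
    (fun i => isSymmetric_toEuclideanLin_iff.mpr (hA i)) (fun i j => by
      refine LinearMap.ext fun v => ?_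
      simp only [Module.End.mul_apply]
      simp [Matrix.toLpLin_apply, (hcomm i j).eq])
  let e : Fin (Module.finrank ℂ (EuclideanSpace ℂ n)) ≃ n :=
    (finCongr hn).trans (Fintype.equivFin n).symm
  set U : Matrix n n ℂ := of fun x y => u (e.symm y) x with hU
  have hUU : Uᴴ * U = 1 := by
    ext x y
    have := orthonormal_iff_ite.mp (u.reindex e).orthonormal x y
    simp only [OrthonormalBasis.reindex_apply, EuclideanSpace.inner_eq_star_dotProduct] at this
    rw [Matrix.one_apply, ← this, dotProduct_comm]
    rfl
  refine ⟨U, hUU, fun i => ⟨fun y => χ (e.symm y) i, ?_⟩⟩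
  have h : A i * U = U * diagonal fun y => χ (e.symm y) i := by
    ext x y
    have := congrArg (fun v : EuclideanSpace ℂ n => v x) (hu i (e.symm y))
    simp only [Matrix.toLpLin_apply, PiLp.smul_apply, smul_eq_mul] at this
    rw [mul_diagonal, mul_comm]
    exact this
  rw [← h, Matrix.mul_assoc, mul_eq_one_comm.mp hUU, Matrix.mul_one]

/-- Commuting normal matrices are simultaneously unitarily diagonalizable. -/
theorem exists_joint_diagonalization (hcomm : ∀ i j, Commute (A i) (A j))
    (hstar : ∀ i j, Commute (A i) (A j)ᴴ) :
    ∃ U : Matrix n n ℂ, Uᴴ * U = 1 ∧ ∀ i, ∃ f : n → ℂ, A i = U * diagonal f * Uᴴ := by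
  have hstar' (i j : ι) : Commute (A i)ᴴ (A j) := (hstar j i).symm
  have hss (i j : ι) : Commute (A i)ᴴ (A j)ᴴ := (hcomm i j).star_star
  obtain ⟨U, hU, h⟩ := exists_joint_diagonalization_of_isHermitian
    (A := fun i : ι ⊕ ι => i.elim (fun i => A i + (A i)ᴴ)
      fun i => Complex.I • (A i - (A i)ᴴ)) (by
        rintro (i | i)
        · exact isHermitian_add_transpose_self (A i)
        · simp [IsHermitian, sub_eq_add_neg, add_comm]) (by
        have hp (i j : ι) : Commute (A i + (A i)ᴴ) (A j + (A j)ᴴ) :=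
          ((hcomm i j).add_right (hstar i j)).add_left ((hstar' i j).add_right (hss i j))
        have hm (i j : ι) : Commute (A i - (A i)ᴴ) (A j - (A j)ᴴ) :=
          ((hcomm i j).sub_right (hstar i j)).sub_left ((hstar' i j).sub_right (hss i j))
        have hpm (i j : ι) : Commute (A i + (A i)ᴴ) (A j - (A j)ᴴ) :=
          ((hcomm i j).sub_right (hstar i j)).add_left ((hstar' i j).sub_right (hss i j))
        rintro (i | i) (j | j)
        · exact hp i j
        · exact (hpm i j).smul_right _
        · exact ((hpm j i).smul_right _).symm
        · exact ((hm i j).smul_right _).smul_left _)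
  refine ⟨U, hU, fun i => ?_⟩
  obtain ⟨f, hf⟩ := h (Sum.inl i)
  obtain ⟨g, hg⟩ := h (Sum.inr i)
  refine ⟨fun x => (1 / 2 : ℂ) * (f x - Complex.I * g x), ?_⟩
  have hd : (diagonal fun x => (1 / 2 : ℂ) * (f x - Complex.I * g x)) =
      (1 / 2 : ℂ) • (diagonal f - Complex.I • diagonal g) := by
    ext x y
    by_cases hxy : x = y
    · simp [hxy]
    · simp [hxy]
  have hA : A i = (1 / 2 : ℂ) • ((A i + (A i)ᴴ) - Complex.I • Complex.I • (A i - (A i)ᴴ)) := by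
    rw [smul_smul, Complex.I_mul_I]
    module
  simp only [Sum.elim_inl, Sum.elim_inr] at hf hg
  rw [hA, hd, hf, hg]
  simp [Matrix.mul_sub, Matrix.sub_mul]

end Diagonalization

section Separable

variable {α β : Type*} [Fintype α] [Fintype β]

theorem Matrix.PosSemidef.tens {σ : Matrix α α ℂ} {τ : Matrix β β ℂ} (hσ : σ.PosSemidef)
    (hτ : τ.PosSemidef) : (tens σ τ).PosSemidef :=
  hσ.kronecker hτ

theorem trace_tens (σ : Matrix α α ℂ) (τ : Matrix β β ℂ) :
    (tens σ τ).trace = σ.trace * τ.trace :=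
  trace_kronecker σ τ

theorem isDensity_vecMulVec {v : α → ℂ} (hv : v ⬝ᵥ star v = 1) :
    IsDensity (vecMulVec v (star v)) :=
  ⟨posSemidef_vecMulVec_self_star v, by rw [trace_vecMulVec, hv]⟩

theorem exists_isDensity [Nonempty α] : ∃ ρ : Matrix α α ℂ, IsDensity ρ := by
  classical
  exact ⟨_, isDensity_vecMulVec (v := Pi.single (Classical.arbitrary α) 1) (by simp)⟩

theorem separableState_of_eq_sum {ι : Type*} [Fintype ι] {ρ : Matrix (α × β) (α × β) ℂ}
    {σ : ι → Matrix α α ℂ} {τ : ι → Matrix β β ℂ} (hσ : ∀ i, IsDensity (σ i))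
    (hτ : ∀ i, (τ i).PosSemidef) (htr : ρ.trace = 1) (hρ : ρ = ∑ i, tens (σ i) (τ i)) :
    SeparableState ρ := by
  have hne : Nonempty β := by
    by_contra h
    rw [not_nonempty_iff] at h
    simp [Matrix.trace] at htr
  obtain ⟨τ₀, hτ₀⟩ := exists_isDensity (α := β)
  have hre (i : ι) : ((τ i).trace.re : ℂ) = (τ i).trace :=
    (Complex.eq_re_of_ofReal_le (hτ i).trace_nonneg).symm
  have hdec (i : ι) : ∃ τ' : Matrix β β ℂ, IsDensity τ' ∧ τ i = (τ i).trace • τ' := by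
    by_cases h : (τ i).trace = 0
    · exact ⟨τ₀, hτ₀, by rw [h, zero_smul, ← (hτ i).trace_eq_zero_iff, h]⟩
    · refine ⟨(τ i).trace⁻¹ • τ i, ⟨(hτ i).smul ?_, ?_⟩, ?_⟩
      · exact inv_nonneg.mpr (hτ i).trace_nonneg
      · rw [trace_smul, smul_eq_mul, inv_mul_cancel₀ h]
      · rw [smul_smul, mul_inv_cancel₀ h, one_smul]
  choose τ' hτ' hττ' using hdec
  let e := (Fintype.equivFin ι).symm
  refine ⟨Fintype.card ι, fun k => (τ (e k)).trace.re, fun k => σ (e k), fun k => τ' (e k),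
    fun k => (Complex.nonneg_iff.mp (hτ (e k)).trace_nonneg).1, ?_, fun k => hσ _, fun k => hτ' _,
    ?_⟩
  · rw [e.sum_comp fun i => (τ i).trace.re, ← Complex.ofReal_inj, Complex.ofReal_sum,
      Complex.ofReal_one, ← htr, hρ, trace_sum]
    simp_rw [hre, trace_tens, (hσ _).2, one_mul]
  · rw [e.sum_comp fun i => ((τ i).trace.re : ℂ) • tens (σ i) (τ' i), hρ]
    refine Finset.sum_congr rfl fun i _ => ?_
    rw [hre, hττ' i]
    ext p q
    have : ((τ i).trace • τ' i).trace = (τ i).trace := by rw [← hττ' i]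
    simp only [this, tens, Matrix.smul_apply, smul_eq_mul]
    ring

theorem SeparableState.posSemidef_reduction [DecidableEq α] [DecidableEq β]
    {ρ : Matrix (α × β) (α × β) ℂ} (h : SeparableState ρ) :
    (tens (ptrB ρ) 1 - ρ).PosSemidef ∧ (tens 1 (ptrA ρ) - ρ).PosSemidef := by
  obtain ⟨k, p, σ, τ, hp, -, hσ, hτ, rfl⟩ := h
  have hp' (i : Fin k) : (0 : ℂ) ≤ p i := by exact_mod_cast hp i
  constructor
  · convert posSemidef_sum Finset.univ fun i _ => ((hσ i).1.tens
      ((hτ i).1.posSemidef_one_sub_of_trace_eq_one (hτ i).2)).smul (hp' i)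
    ext x y
    have htr (i : Fin k) : ∑ j, τ i j j = 1 := (hτ i).2
    have hB : ptrB (∑ i, (p i : ℂ) • tens (σ i) (τ i)) x.1 y.1 = ∑ i, p i * σ i x.1 y.1 := by
      simp only [ptrB, Matrix.sum_apply, Matrix.smul_apply, tens, smul_eq_mul]
      rw [Finset.sum_comm]
      simp_rw [← mul_assoc, ← Finset.mul_sum, htr, mul_one]
    simp only [Matrix.sub_apply, tens, hB, Matrix.sum_apply, Matrix.smul_apply, smul_eq_mul,
      Finset.sum_mul, ← Finset.sum_sub_distrib]
    exact Finset.sum_congr rfl fun i _ => by ring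
  · convert posSemidef_sum Finset.univ fun i _ => (((hσ i).1.posSemidef_one_sub_of_trace_eq_one
      (hσ i).2).tens (hτ i).1).smul (hp' i)
    ext x y
    have htr (i : Fin k) : ∑ j, σ i j j = 1 := (hσ i).2
    have hA : ptrA (∑ i, (p i : ℂ) • tens (σ i) (τ i)) x.2 y.2 = ∑ i, p i * τ i x.2 y.2 := by
      simp only [ptrA, Matrix.sum_apply, Matrix.smul_apply, tens, smul_eq_mul]
      rw [Finset.sum_comm]
      simp_rw [← Finset.mul_sum, ← Finset.sum_mul, htr, one_mul]
    simp only [Matrix.sub_apply, tens, hA, Matrix.sum_apply, Matrix.smul_apply, smul_eq_mul,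
      Finset.mul_sum, ← Finset.sum_sub_distrib]
    exact Finset.sum_congr rfl fun i _ => by ring

theorem separableState_of_commute {γ : Type*} [Fintype γ] {ρ : Matrix (α × β) (α × β) ℂ}
    {M : β → Matrix γ α ℂ} (hρ : ∀ p q, ρ p q = ((M p.2)ᴴ * M q.2) p.1 q.1)
    (htr : ρ.trace = 1)
    (hcomm : ∀ b b' d d', Commute ((M b)ᴴ * M b') ((M d)ᴴ * M d')) : SeparableState ρ := by
  classical
  obtain ⟨U, hU, h⟩ := exists_joint_diagonalization
    (A := fun x : β × β => (M x.1)ᴴ * M x.2) (fun x y => hcomm _ _ _ _) (fun x y => by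
      rw [conjTranspose_mul, conjTranspose_conjTranspose]
      exact hcomm _ _ _ _)
  choose f hf using h
  have hfM (b b' : β) (i : α) : f (b, b') i = ((M b * U)ᴴ * (M b' * U)) i i := by
    have e : (M b * U)ᴴ * (M b' * U) = Uᴴ * ((M b)ᴴ * M b') * U := by
      simp only [conjTranspose_mul, Matrix.mul_assoc]
    have e' : Uᴴ * ((M b)ᴴ * M b') * U = (Uᴴ * U) * diagonal (f (b, b')) * (Uᴴ * U) := by
      rw [hf (b, b')]
      simp only [Matrix.mul_assoc]
    rw [e, e', hU, Matrix.one_mul, Matrix.mul_one, diagonal_apply_eq]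
  refine separableState_of_eq_sum (ι := α)
    (σ := fun i => vecMulVec (fun x => U x i) (star fun x => U x i))
    (τ := fun i => of fun b b' => f (b, b') i) (fun i => isDensity_vecMulVec ?_) (fun i => ?_) htr
    ?_
  · have := congrFun (congrFun hU i) i
    rw [Matrix.one_apply_eq] at this
    rw [← this, dotProduct_comm]
    rfl
  · convert! posSemidef_conjTranspose_mul_self (of fun c b => (M b * U) c i) using 1
    ext b b'
    exact hfM b b' i
  · ext p q
    rw [hρ, hf (p.2, q.2), Matrix.mul_apply, Matrix.sum_apply]
    refine Finset.sum_congr rfl fun i _ => ?_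
    simp only [mul_diagonal, conjTranspose_apply, tens, vecMulVec_apply, Pi.star_apply, of_apply]
    ring

end Separable

/-- Theorem 1 of the paper: if the reduced state ρ_BC of a
tripartite pure state is PPT, then ρ_AB is separable iff it satisfies the
reduction criterion. -/
theorem separable_iff_reduction_of_ppt_env {a b c : ℕ}
    (ψ : Fin a × Fin b × Fin c → ℂ) (hψ : UnitVec ψ)
    (hppt : (ptransB (rhoBC ψ)).PosSemidef) :
    SeparableState (rhoAB ψ) ↔
      ((tens (rhoA ψ) (1 : Matrix (Fin b) (Fin b) ℂ) - rhoAB ψ).PosSemidef ∧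
       (tens (1 : Matrix (Fin a) (Fin a) ℂ) (rhoB ψ) - rhoAB ψ).PosSemidef) := by
  refine ⟨fun h => h.posSemidef_reduction, fun h => ?_⟩
  let M : Fin b → Matrix (Fin c) (Fin a) ℂ := fun y => of fun z x => star (ψ (x, y, z))
  have hAB (p q : Fin a × Fin b) : rhoAB ψ p q = ((M p.2)ᴴ * M q.2) p.1 q.1 := by
    simp [rhoAB, M, Matrix.mul_apply]
  refine separableState_of_commute hAB ?_
    (commute_conjTranspose_mul_of_reduction_of_ppt (M := M) ?_ ?_)
  · rw [← Complex.ofReal_one, ← hψ]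
    simp [rhoAB, Matrix.trace, Fintype.sum_prod_type, Complex.mul_conj]
  · convert h.1.submatrix Prod.swap
    ext ⟨y, x⟩ ⟨y', x'⟩
    have hA : rhoA ψ x x' = (∑ d, (M d)ᴴ * M d) x x' := by
      simp [rhoA, M, Matrix.mul_apply, Matrix.sum_apply]
    by_cases e : y = y'
    · simp [blockMat, tens, hAB, hA, e]
    · simp [blockMat, tens, hAB, e]
  · convert! hppt using 1
    ext ⟨y, z⟩ ⟨y', z'⟩
    simp [blockMat, ptransB, rhoBC, M, Matrix.mul_apply, mul_comm]

end
end

section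
/- Let |Ψ⟩_ABC be a tripartite pure state whose reduced state ρ_BC is PPT. If the eigenvalue vectors of ρ_A and ρ_AB majorize each other (i.e., ρ_A and ρ_AB have the same eigenvalue multiset), then ρ_BC is separable. -/
open Matrix BigOperators
open scoped ComplexOrder

noncomputable section

open scoped InnerProductSpace

/-- In finite dimension a hyponormal operator is normal. -/
lemma isStarNormal_of_norm_adjoint_le {E : Type*} [NormedAddCommGroup E] [InnerProductSpace ℂ E]
    [FiniteDimensional ℂ E] [CompleteSpace E] (N : E →L[ℂ] E)
    (h : ∀ y, ‖ContinuousLinearMap.adjoint N y‖ ≤ ‖N y‖) : IsStarNormal N := by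
  have key : ∀ y, ⟪(star N * N - N * star N) y, y⟫_ℂ =
      ((‖N y‖ ^ 2 - ‖ContinuousLinearMap.adjoint N y‖ ^ 2 : ℝ) : ℂ) := by
    intro y
    have h1 : ⟪(star N * N) y, y⟫_ℂ = ((‖N y‖ ^ 2 : ℝ) : ℂ) := by
      simp [ContinuousLinearMap.star_eq_adjoint, ContinuousLinearMap.adjoint_inner_left,
        inner_self_eq_norm_sq_to_K]
    have h2 : ⟪(N * star N) y, y⟫_ℂ = ((‖ContinuousLinearMap.adjoint N y‖ ^ 2 : ℝ) : ℂ) := by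
      simp [ContinuousLinearMap.star_eq_adjoint, ← ContinuousLinearMap.adjoint_inner_right,
        inner_self_eq_norm_sq_to_K]
    rw [_root_.sub_apply, inner_sub_left, h1, h2]
    push_cast
    rfl
  let T : E →ₗ[ℂ] E := (star N * N - N * star N : E →L[ℂ] E).toLinearMap
  have hpos : T.IsPositive := by
    rw [LinearMap.isPositive_iff_complex]
    intro y
    have hk : ⟪T y, y⟫_ℂ = _ := key y
    rw [hk]
    refine ⟨by simp only [Complex.ofReal_re, RCLike.re_to_complex], ?_⟩
    have := pow_le_pow_left₀ (norm_nonneg _) (h y) 2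
    simpa only [RCLike.re_to_complex, Complex.ofReal_re, sub_nonneg] using this
  have htr : LinearMap.trace ℂ E T = 0 := by
    have : T = (star N : E →L[ℂ] E).toLinearMap * N.toLinearMap
        - N.toLinearMap * (star N : E →L[ℂ] E).toLinearMap := rfl
    rw [this, map_sub, LinearMap.trace_mul_comm, sub_self]
  have hT0 : T = 0 := by
    have hm := (LinearMap.posSemidef_toMatrix_iff (stdOrthonormalBasis ℂ E)).mpr hpos
    rw [LinearMap.trace_eq_matrix_trace ℂ (stdOrthonormalBasis ℂ E).toBasis,
      hm.trace_eq_zero_iff] at htr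
    exact (LinearEquiv.map_eq_zero_iff _).mp htr
  refine ⟨?_⟩
  have : star N * N - N * star N = 0 := by
    ext y
    exact congrArg (fun S : E →ₗ[ℂ] E => S y) hT0
  exact sub_eq_zero.mp this

/-- A linear space of normal operators is commutative. -/
lemma commute_of_forall_isStarNormal {V A : Type*} [AddCommGroup V] [Module ℂ V] [CStarAlgebra A]
    (N : V →ₗ[ℂ] A) (hN : ∀ v, IsStarNormal (N v)) (v w : V) : Commute (N v) (N w) := by
  have hcomm : ∀ v, star (N v) * N v = N v * star (N v) := fun v => (hN v).star_comm_self.eq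
  have h1 := hcomm (v + w)
  have h2 := hcomm (v + Complex.I • w)
  simp only [map_add, map_smul, star_add, star_smul, mul_add, add_mul, hcomm, smul_mul_assoc,
    mul_smul_comm, Complex.star_def, Complex.conj_I, neg_smul, mul_neg, neg_mul] at h1 h2
  have h3 : star (N w) * N v + star (N v) * N w = N v * star (N w) + N w * star (N v) := by
    linear_combination (norm := module) h1
  have h4 : Complex.I • (star (N v) * N w - star (N w) * N v)
      = Complex.I • (N w * star (N v) - N v * star (N w)) := by
    simp only [smul_sub]
    linear_combination (norm := module) h2
  have h5 := smul_right_injective A Complex.I_ne_zero h4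
  have h6 : (2 : ℂ) • (star (N v) * N w) = (2 : ℂ) • (N w * star (N v)) := by
    simp only [two_smul]
    linear_combination (norm := module) h3 + h5
  have h7 : star (N v) * N w = N w * star (N v) := smul_right_injective A two_ne_zero h6
  have hs : IsStarNormal (star (N v)) := inferInstance
  simpa using hs.commute_star_left h7

/-- A linear space of normal operators is diagonal in a common orthonormal basis. -/
lemma exists_orthonormalBasis_adjoint_apply_eq_smul {V E : Type*} [AddCommGroup V] [Module ℂ V]
    [NormedAddCommGroup E] [InnerProductSpace ℂ E] [FiniteDimensional ℂ E] [CompleteSpace E]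
    (N : V →ₗ[ℂ] (E →L[ℂ] E)) (hN : ∀ v, IsStarNormal (N v)) :
    ∃ (n : ℕ) (u : OrthonormalBasis (Fin n) ℂ E) (l : Fin n → V → ℂ),
      ∀ i v, ContinuousLinearMap.adjoint (N v) (u i) = l i v • u i := by
  classical
  have hc : ∀ v w, Commute (N v) (N w) := commute_of_forall_isStarNormal N hN
  have hc' : ∀ v w, Commute (star (N v)) (N w) := fun v w => (hN v).commute_star_left (hc v w)
  let S : V → (E →L[ℂ] E) := fun v => N v + star (N v)
  have hS : ∀ v w, Commute (S v) (S w) := fun v w =>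
    ((hc v w).add_right (hc' w v).symm).add_left ((hc' v w).add_right (hc v w).star_star)
  let T : V → (E →ₗ[ℂ] E) := fun v => (S v).toLinearMap
  have hT : ∀ v, (T v).IsSymmetric := fun v =>
    ContinuousLinearMap.isSelfAdjoint_iff_isSymmetric.mp (IsSelfAdjoint.add_star_self (N v))
  have hTc : Pairwise (Function.onFun Commute T) := fun v w _ =>
    congrArg ContinuousLinearMap.toLinearMap (hS v w).eq
  have hint := LinearMap.IsSymmetric.directSum_isInternal_of_pairwise_commute hT hTc
  let b := hint.collectedBasis fun γ => (stdOrthonormalBasis ℂ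
    (⨅ j, Module.End.eigenspace (T j) (γ j) : Submodule ℂ E)).toBasis
  have hb : Orthonormal ℂ b :=
    hint.collectedBasis_orthonormal (LinearMap.IsSymmetric.orthogonalFamily_iInf_eigenspaces hT)
      fun γ => by simp
  have : Finite ((γ : V → ℂ) × Fin (Module.finrank ℂ
    (⨅ j, Module.End.eigenspace (T j) (γ j) : Submodule ℂ E))) := Module.Finite.finite_basis b
  have := Fintype.ofFinite ((γ : V → ℂ) × Fin (Module.finrank ℂ
    (⨅ j, Module.End.eigenspace (T j) (γ j) : Submodule ℂ E)))
  refine ⟨_, (b.toOrthonormalBasis hb).reindex (Fintype.equivFin _), fun i v =>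
    (2⁻¹ : ℂ) * (((Fintype.equivFin _).symm i).1 v
      + Complex.I * ((Fintype.equivFin _).symm i).1 (Complex.I • v)), fun i v => ?_⟩
  simp only [OrthonormalBasis.reindex_apply, Module.Basis.coe_toOrthonormalBasis]
  generalize (Fintype.equivFin _).symm i = j
  have hmem : ∀ v, S v (b j) = j.1 v • b j := fun v => by
    have := hint.collectedBasis_mem (fun γ => (stdOrthonormalBasis ℂ
      (⨅ j, Module.End.eigenspace (T j) (γ j) : Submodule ℂ E)).toBasis) j
    exact Module.End.mem_eigenspace_iff.mp ((Submodule.mem_iInf _).mp this v)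
  have hadj : star (N v) = (2⁻¹ : ℂ) • (S v + Complex.I • S (Complex.I • v)) := by
    simp only [S, map_smul, star_smul, smul_add, smul_smul, Complex.star_def, Complex.conj_I]
    have : (2⁻¹ : ℂ) * (Complex.I * Complex.I) = - 2⁻¹ := by simp
    rw [this, mul_neg, Complex.I_mul_I, neg_neg, mul_one]
    module
  rw [← ContinuousLinearMap.star_eq_adjoint, hadj]
  simp only [_root_.smul_apply, _root_.add_apply, hmem]
  module

/-- The bilinear positivity condition satisfied by the slices `M e : F → E` of a tripartite vector
whose reduced state is PPT. -/
def PPTSlices {V E F : Type*} [AddCommGroup V] [Module ℂ V] [NormedAddCommGroup E]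
    [InnerProductSpace ℂ E] [AddCommGroup F] [Module ℂ F] (M : V →ₗ[ℂ] F →ₗ[ℂ] E) : Prop :=
  ∀ e f x y, 0 ≤ ‖M e x‖ ^ 2 + 2 * (⟪M f x, M e y⟫_ℂ).re + ‖M f y‖ ^ 2

section Slices

variable {V E F : Type*} [AddCommGroup V] [Module ℂ V] [NormedAddCommGroup E]
  [InnerProductSpace ℂ E] [AddCommGroup F] [Module ℂ F] {M : V →ₗ[ℂ] F →ₗ[ℂ] E}

lemma PPTSlices.inner_eq_zero (hM : PPTSlices M) {e : V} {v : F} (hv : M e v = 0) (f : V) (y : F) :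
    ⟪M f v, M e y⟫_ℂ = 0 := by
  by_contra hz
  set z := ⟪M f v, M e y⟫_ℂ with hzdef
  have hpos : 0 < Complex.normSq z := Complex.normSq_pos.mpr hz
  set t : ℝ := (‖M f y‖ ^ 2 + 1) / Complex.normSq z with ht
  have h := hM e f ((-(t : ℂ) * z) • v) y
  simp only [map_smul, hv, smul_zero, norm_zero, inner_smul_left, ← hzdef, map_mul, map_neg,
    Complex.conj_ofReal] at h
  have h1 : -(t : ℂ) * (starRingEnd ℂ) z * z = ((-(t * Complex.normSq z) : ℝ) : ℂ) := by
    rw [mul_assoc, mul_comm ((starRingEnd ℂ) z), Complex.mul_conj]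
    push_cast
    ring
  have h2 : t * Complex.normSq z = ‖M f y‖ ^ 2 + 1 := div_mul_cancel₀ _ hpos.ne'
  rw [h1, Complex.ofReal_re, h2] at h
  nlinarith [sq_nonneg ‖M f y‖]

variable [FiniteDimensional ℂ E] [FiniteDimensional ℂ F]

/-- A slice of maximal rank has the smallest kernel. -/
lemma PPTSlices.exists_ker_le (hM : PPTSlices M) :
    ∃ e, ∀ f, LinearMap.ker (M e) ≤ LinearMap.ker (M f) := by
  let r : V → ℕ := fun e => Module.finrank ℂ (LinearMap.range (M e))
  have hbdd : BddAbove (Set.range r) :=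
    ⟨Module.finrank ℂ E, by rintro _ ⟨e, rfl⟩; exact Submodule.finrank_le _⟩
  obtain ⟨e, he⟩ := Nat.sSup_mem (Set.range_nonempty r) hbdd
  have hmax : ∀ f, r f ≤ r e := fun f => he ▸ le_csSup hbdd ⟨f, rfl⟩
  refine ⟨e, fun f v hv => ?_⟩
  rw [LinearMap.mem_ker] at hv ⊢
  by_contra hne
  let b := Module.finBasis ℂ (LinearMap.range (M e))
  choose x hx using fun i => (b i).2
  let w : ℂ → Option (Fin (r e)) → E := fun t o => o.elim (M f v) fun i => M (e + t • f) (x i)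
  have hw0 : LinearIndependent ℂ (w 0) := by
    have hli : LinearIndependent ℂ fun i => M e (x i) := by
      simp only [hx]
      exact b.linearIndependent.map' _ (Submodule.ker_subtype _)
    have : w 0 = fun o => o.casesOn' (M f v) fun i => M e (x i) := by
      funext o
      cases o <;> simp [w]
    rw [this]
    refine linearIndependent_option'.mpr ⟨hli, fun hmem => hne ?_⟩
    have hle : Submodule.span ℂ (Set.range fun i => M e (x i)) ≤ LinearMap.range (M e) :=
      Submodule.span_le.mpr (by rintro _ ⟨i, rfl⟩; exact ⟨_, rfl⟩)
    obtain ⟨y, hy⟩ := hle hmem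
    have := hM.inner_eq_zero hv f y
    rwa [hy, inner_self_eq_zero] at this
  have hcont : Continuous w := by
    refine continuous_pi fun o => ?_
    cases o with
    | none => exact continuous_const
    | some i =>
      simp only [w, Option.elim, map_add, map_smul, LinearMap.add_apply, LinearMap.smul_apply]
      fun_prop
  have hopen := (isOpen_setOfPred_linearIndependent (𝕜 := ℂ)
    (E := E) (ι := Option (Fin (r e)))).preimage hcont
  obtain ⟨t, ht0, ht⟩ : ∃ t : ℂ, t ≠ 0 ∧ LinearIndependent ℂ (w t) := by
    have hev : ∀ᶠ t in nhds (0 : ℂ), LinearIndependent ℂ (w t) := hopen.mem_nhds hw0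
    obtain ⟨t, h1, h2⟩ := ((hev.filter_mono nhdsWithin_le_nhds).and
      (self_mem_nhdsWithin : {(0 : ℂ)}ᶜ ∈ nhdsWithin 0 {(0 : ℂ)}ᶜ)).exists
    exact ⟨t, h2, h1⟩
  have hmem : ∀ o, w t o ∈ LinearMap.range (M (e + t • f)) := by
    rintro (_ | i)
    · refine ⟨t⁻¹ • v, ?_⟩
      simp [w, hv, ht0]
    · exact ⟨_, rfl⟩
  have hli : LinearIndependent ℂ fun o => (⟨w t o, hmem o⟩ : LinearMap.range (M (e + t • f))) :=
    LinearIndependent.of_comp (Submodule.subtype _) ht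
  have hcard := hli.fintype_card_le_finrank
  rw [Fintype.card_option, Fintype.card_fin] at hcard
  exact absurd (hmax (e + t • f)) (by simp only [r] at hcard ⊢; omega)

/-- If the slices have no more joint range than joint corank, then a PPT family of slices is
simultaneously diagonal in an orthonormal basis of `E`, up to a common right factor. -/
lemma PPTSlices.exists_orthonormalBasis_inner_eq (hM : PPTSlices M) (R : Submodule ℂ E)
    (K : Submodule ℂ F) (hR : ∀ f, LinearMap.range (M f) ≤ R) (hK : ⨅ f, LinearMap.ker (M f) ≤ K)
    (hRK : Module.finrank ℂ R + Module.finrank ℂ K ≤ Module.finrank ℂ F) :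
    ∃ (n : ℕ) (u : OrthonormalBasis (Fin n) ℂ E) (l : Fin n → V → ℂ) (t : Fin n → F → ℂ),
      ∀ i f x, ⟪u i, M f x⟫_ℂ = l i f * t i x := by
  obtain ⟨e, he⟩ := hM.exists_ker_le
  have hrange : LinearMap.range (M e) = R := by
    refine Submodule.eq_of_le_of_finrank_le (hR e) ?_
    have h1 := LinearMap.finrank_range_add_finrank_ker (M e)
    have h2 := Submodule.finrank_mono ((le_iInf he).trans hK)
    omega
  have := FiniteDimensional.complete ℂ E
  obtain ⟨s, hs⟩ := (M e).rangeRestrict.exists_rightInverse_of_surjective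
    (LinearMap.range_rangeRestrict _)
  let P := (LinearMap.range (M e)).orthogonalProjectionOnto
  let G : E →ₗ[ℂ] F := s ∘ₗ P.toLinearMap
  have hG : ∀ y, M e (G y) = P y := fun y =>
    congrArg Subtype.val (LinearMap.congr_fun hs (P y))
  have hPM : ∀ f x, (P (M f x) : E) = M f x := fun f x =>
    Submodule.starProjection_eq_self_iff.mpr (hrange ▸ hR f ⟨x, rfl⟩)
  have hGM : ∀ f x, M f (G (M e x)) = M f x := fun f x => by
    have : G (M e x) - x ∈ LinearMap.ker (M e) := by
      rw [LinearMap.mem_ker, map_sub, hG, hPM, sub_self]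
    simpa [sub_eq_zero] using he f this
  let N : V →ₗ[ℂ] (E →L[ℂ] E) :=
    { toFun := fun f => (M f ∘ₗ G).toContinuousLinearMap
      map_add' := fun f g => by ext y; simp
      map_smul' := fun c f => by ext y; simp }
  have hNG : ∀ f y, N f y = M f (G y) := fun f y => rfl
  have hN : ∀ f, IsStarNormal (N f) := fun f => by
    refine isStarNormal_of_norm_adjoint_le _ fun y => ?_
    have h := hM e f (G (-ContinuousLinearMap.adjoint (N f) y)) (G y)
    have h1 : ⟪M f (G (-ContinuousLinearMap.adjoint (N f) y)), M e (G y)⟫_ℂ =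
        ((-‖ContinuousLinearMap.adjoint (N f) y‖ ^ 2 : ℝ) : ℂ) := by
      have h2 : ∀ z, ⟪M f z, (P y : E)⟫_ℂ = ⟪M f z, y⟫_ℂ := fun z => by
        conv_rhs => rw [← hPM f z]
        exact (Submodule.inner_starProjection_left_eq_right _ _ _).symm
      rw [hG, h2, ← hNG, ← ContinuousLinearMap.adjoint_inner_right, inner_neg_left,
        inner_self_eq_norm_sq_to_K]
      push_cast
      rfl
    have h3 : ‖M e (G (-ContinuousLinearMap.adjoint (N f) y))‖ ≤
        ‖ContinuousLinearMap.adjoint (N f) y‖ := by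
      rw [hG, ← norm_neg (ContinuousLinearMap.adjoint (N f) y)]
      exact Submodule.norm_orthogonalProjectionOnto_apply_le _ _
    rw [h1, Complex.ofReal_re, ← hNG f y] at h
    have h4 := pow_le_pow_left₀ (norm_nonneg _) h3 2
    exact le_of_sq_le_sq (by linarith) (norm_nonneg _)
  obtain ⟨n, u, l, hu⟩ := exists_orthonormalBasis_adjoint_apply_eq_smul N hN
  refine ⟨n, u, fun i f => (starRingEnd ℂ) (l i f), fun i x => ⟪u i, M e x⟫_ℂ, fun i f x => ?_⟩
  rw [← inner_smul_left, ← hu, ContinuousLinearMap.adjoint_inner_left, hNG, hGM]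

end Slices

/-- Mutual majorization controls the number of nonzero entries. -/
lemma Majorizes.card_ne_zero_le {α β : Type*} [Fintype α] [Fintype β] {x : α → ℝ} {y : β → ℝ}
    (h : Majorizes x y) (hx : ∀ i, 0 ≤ x i) :
    Fintype.card {i // x i ≠ 0} ≤ Fintype.card {i // y i ≠ 0} := by
  classical
  obtain ⟨S, hS, hle⟩ := h.1 (Finset.univ.filter fun i => y i ≠ 0)
  rw [Finset.sum_filter_ne_zero, ← h.2, ← Finset.sum_add_sum_compl S] at hle
  have h0 : ∑ i ∈ Sᶜ, x i = 0 :=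
    le_antisymm (by linarith) (Finset.sum_nonneg fun i _ => hx i)
  rw [Finset.sum_eq_zero_iff_of_nonneg fun i _ => hx i] at h0
  rw [Fintype.card_subtype, Fintype.card_subtype]
  refine (Finset.card_le_card fun i hi => ?_).trans hS
  by_contra hiS
  exact (Finset.mem_filter.mp hi).2 (h0 i (Finset.mem_compl.mpr hiS))

lemma trace_projv {α : Type*} [Fintype α] (v : α → ℂ) :
    (projv v).trace = ((∑ x, Complex.normSq (v x) : ℝ) : ℂ) := by
  simp [Matrix.trace, projv, Complex.mul_conj]

lemma posSemidef_projv {α : Type*} [Fintype α] (v : α → ℂ) : (projv v).PosSemidef :=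
  Matrix.posSemidef_vecMulVec_self_star v

lemma isDensity_smul_projv {α : Type*} [Fintype α] {v : α → ℂ}
    (hv : ∑ x, Complex.normSq (v x) ≠ 0) :
    IsDensity ((((∑ x, Complex.normSq (v x))⁻¹ : ℝ) : ℂ) • projv v) := by
  have hnn : 0 ≤ ∑ x, Complex.normSq (v x) := Finset.sum_nonneg fun _ _ => Complex.normSq_nonneg _
  refine ⟨(posSemidef_projv v).smul (Complex.zero_le_real.mpr (inv_nonneg.mpr hnn)), ?_⟩
  rw [Matrix.trace_smul, trace_projv, smul_eq_mul, ← Complex.ofReal_mul, inv_mul_cancel₀ hv,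
    Complex.ofReal_one]

/-- A rank-one positive matrix is a multiple of a density matrix. -/
lemma exists_isDensity_projv_eq_smul {α : Type*} [Fintype α] [Nonempty α] (v : α → ℂ) :
    ∃ σ : Matrix α α ℂ, IsDensity σ ∧
      projv v = ((∑ x, Complex.normSq (v x) : ℝ) : ℂ) • σ := by
  classical
  by_cases hv : ∑ x, Complex.normSq (v x) = 0
  · obtain ⟨i⟩ := ‹Nonempty α›
    have h1 : ∑ x, Complex.normSq ((Pi.single i 1 : α → ℂ) x) = 1 := by
      rw [Finset.sum_eq_single i] <;> simp +contextual
    refine ⟨_, isDensity_smul_projv (v := Pi.single i 1) (by rw [h1]; exact one_ne_zero), ?_⟩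
    have hv0 : ∀ x, v x = 0 := fun x => Complex.normSq_eq_zero.mp
      ((Finset.sum_eq_zero_iff_of_nonneg fun _ _ => Complex.normSq_nonneg _).mp hv x
        (Finset.mem_univ x))
    rw [hv, Complex.ofReal_zero, zero_smul]
    ext x y
    simp [projv, hv0]
  · refine ⟨_, isDensity_smul_projv hv, ?_⟩
    rw [smul_smul, ← Complex.ofReal_mul, mul_inv_cancel₀ hv, Complex.ofReal_one, one_smul]

/-- A trace-one sum of projections onto product vectors is separable. -/
lemma separableState_of_eq_sum_tens_projv {β γ : Type*} [Fintype β] [Fintype γ] {n : ℕ}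
    {ρ : Matrix (β × γ) (β × γ) ℂ} (hρ : ρ.trace = 1) (v : Fin n → β → ℂ) (w : Fin n → γ → ℂ)
    (h : ρ = ∑ i, tens (projv (v i)) (projv (w i))) : SeparableState ρ := by
  have hne : Nonempty (β × γ) := by
    by_contra hemp
    rw [not_nonempty_iff] at hemp
    simp [Matrix.trace] at hρ
  have hβ : Nonempty β := hne.map Prod.fst
  have hγ : Nonempty γ := hne.map Prod.snd
  choose σ hσ hvσ using fun i => exists_isDensity_projv_eq_smul (v i)
  choose τ hτ hwτ using fun i => exists_isDensity_projv_eq_smul (w i)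
  let p : Fin n → ℝ := fun i =>
    (∑ x, Complex.normSq (v i x)) * ∑ x, Complex.normSq (w i x)
  have hdec : ρ = ∑ i, (p i : ℂ) • tens (σ i) (τ i) := by
    rw [h]
    refine Finset.sum_congr rfl fun i _ => ?_
    rw [hvσ, hwτ]
    ext x y
    simp only [tens, p, Matrix.smul_apply, smul_eq_mul, Complex.ofReal_mul]
    ring
  have htr : ∀ i, (tens (σ i) (τ i)).trace = 1 := fun i => by
    have : (tens (σ i) (τ i)).trace = (σ i).trace * (τ i).trace := by
      simp only [Matrix.trace, Matrix.diag, tens, Fintype.sum_prod_type, Finset.sum_mul_sum]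
    rw [this, (hσ i).2, (hτ i).2, one_mul]
  refine ⟨n, p, σ, τ, fun i => mul_nonneg (Finset.sum_nonneg fun _ _ => Complex.normSq_nonneg _)
    (Finset.sum_nonneg fun _ _ => Complex.normSq_nonneg _), ?_, hσ, hτ, hdec⟩
  have h1 := hρ
  rw [hdec, Matrix.trace_sum] at h1
  simp only [Matrix.trace_smul, htr, smul_eq_mul, mul_one] at h1
  exact_mod_cast h1

section Tripartite

/-- The matrix of a tripartite vector across the cut between the first system and the others. -/
def flattenA {α β γ : Type*} (ψ : α × β × γ → ℂ) : Matrix α (β × γ) ℂ :=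
  Matrix.of fun i p => ψ (i, p)

/-- The matrix of a tripartite vector across the cut between the last system and the others. -/
def flattenAB {α β γ : Type*} (ψ : α × β × γ → ℂ) : Matrix (α × β) γ ℂ :=
  Matrix.of fun p k => ψ (p.1, p.2, k)

lemma rhoA_eq_mul_conjTranspose {α β γ : Type*} [Fintype β] [Fintype γ] (ψ : α × β × γ → ℂ) :
    rhoA ψ = flattenA ψ * (flattenA ψ)ᴴ := by
  ext i j
  simp [rhoA, flattenA, Matrix.mul_apply, Fintype.sum_prod_type]

lemma rhoAB_eq_mul_conjTranspose {α β γ : Type*} [Fintype γ] (ψ : α × β × γ → ℂ) :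
    rhoAB ψ = flattenAB ψ * (flattenAB ψ)ᴴ := by
  ext p q
  simp [rhoAB, flattenAB, Matrix.mul_apply]

variable {a b c : ℕ} (ψ : Fin a × Fin b × Fin c → ℂ)

/-- The slices `∑ b, e b • ψ (·, b, ·)` of a tripartite vector, as operators from the third system
to the first. -/
def slices : (Fin b → ℂ) →ₗ[ℂ] (Fin c → ℂ) →ₗ[ℂ] EuclideanSpace ℂ (Fin a) :=
  LinearMap.mk₂ ℂ (fun e x => WithLp.toLp 2 fun i => ∑ j, e j * ∑ k, ψ (i, j, k) * x k)
    (fun e f x => by ext i; simp [add_mul, Finset.sum_add_distrib])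
    (fun r e x => by ext i; simp [Finset.mul_sum, mul_assoc])
    (fun e x y => by ext i; simp [mul_add, Finset.sum_add_distrib])
    (fun r e x => by ext i; simp [Finset.mul_sum, mul_left_comm])

lemma slices_apply (e : Fin b → ℂ) (x : Fin c → ℂ) (i : Fin a) :
    slices ψ e x i = ∑ j, e j * ∑ k, ψ (i, j, k) * x k := rfl

lemma slices_single (j : Fin b) (k : Fin c) (i : Fin a) :
    slices ψ (Pi.single j 1) (Pi.single k 1) i = ψ (i, j, k) := by
  simp [slices_apply, Pi.single_apply]

lemma rhoBC_eq_inner (p q : Fin b × Fin c) :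
    rhoBC ψ p q = ⟪slices ψ (Pi.single q.1 1) (Pi.single q.2 1),
      slices ψ (Pi.single p.1 1) (Pi.single p.2 1)⟫_ℂ := by
  simp [rhoBC, PiLp.inner_apply, slices_single]

lemma trace_rhoBC {ψ : Fin a × Fin b × Fin c → ℂ} (hψ : UnitVec ψ) : (rhoBC ψ).trace = 1 := by
  simp only [Matrix.trace, Matrix.diag, rhoBC, Complex.mul_conj]
  rw [Finset.sum_comm]
  rw [UnitVec, Fintype.sum_prod_type] at hψ
  exact_mod_cast hψ

lemma pptSlices_slices (h : (ptransB (rhoBC ψ)).PosSemidef) : PPTSlices (slices ψ) := by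
  intro e f x y
  let z : Fin b × Fin c → ℂ := fun p => star (e p.1) * x p.2 + star (f p.1) * y p.2
  have h0 := h.re_dotProduct_nonneg z
  have key : star z ⬝ᵥ (ptransB (rhoBC ψ) *ᵥ z) =
      ⟪slices ψ e x, slices ψ e x⟫_ℂ + ⟪slices ψ f x, slices ψ e y⟫_ℂ
        + ⟪slices ψ e y, slices ψ f x⟫_ℂ + ⟪slices ψ f y, slices ψ f y⟫_ℂ := by
    have hz : ∀ i j j', ∑ k, ψ (i, j', k) * z (j, k) =
        star (e j) * (∑ k, ψ (i, j', k) * x k) + star (f j) * ∑ k, ψ (i, j', k) * y k := by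
      intro i j j'
      simp only [z, mul_add, Finset.sum_add_distrib, Finset.mul_sum, mul_left_comm]
    have hsum : star z ⬝ᵥ (ptransB (rhoBC ψ) *ᵥ z) = ∑ i, ∑ j, ∑ j',
        star (∑ k, ψ (i, j', k) * z (j, k)) * ∑ k, ψ (i, j, k) * z (j', k) := by
      simp only [dotProduct, Matrix.mulVec, Pi.star_apply, ptransB, rhoBC, Fintype.sum_prod_type,
        star_sum, star_mul', Finset.mul_sum, Finset.sum_mul]
      rw [Finset.sum_comm (γ := Fin a)]
      refine Finset.sum_congr rfl fun j _ => ?_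
      rw [Finset.sum_comm, Finset.sum_comm (γ := Fin a)]
      refine Finset.sum_congr rfl fun j' _ => ?_
      rw [Finset.sum_comm, Finset.sum_comm (γ := Fin a)]
      refine Finset.sum_congr rfl fun k' _ => ?_
      rw [Finset.sum_comm]
      refine Finset.sum_congr rfl fun i _ => Finset.sum_congr rfl fun k _ => ?_
      simp only [starRingEnd_apply]
      ring
    rw [hsum]
    simp only [PiLp.inner_apply, ← Finset.sum_add_distrib, slices_apply, hz]
    refine Finset.sum_congr rfl fun i _ => ?_
    simp only [RCLike.inner_apply, map_sum, Finset.sum_mul_sum, ← Finset.sum_add_distrib]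
    refine Finset.sum_congr rfl fun j _ => Finset.sum_congr rfl fun j' _ => ?_
    simp only [starRingEnd_apply, star_add, star_mul', star_star]
    ring
  rw [key] at h0
  have h1 : (⟪slices ψ e y, slices ψ f x⟫_ℂ).re = (⟪slices ψ f x, slices ψ e y⟫_ℂ).re :=
    inner_re_symm (𝕜 := ℂ) _ _
  rw [RCLike.re_to_complex, Complex.add_re, Complex.add_re, Complex.add_re, h1,
    ← RCLike.re_to_complex, ← RCLike.re_to_complex, inner_self_eq_norm_sq,
    ← RCLike.re_to_complex, inner_self_eq_norm_sq, RCLike.re_to_complex] at h0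
  linarith

/-- The joint range of the slices, together with their joint kernel, is controlled by the ranks of
the reduced states on the first and on the first two systems. -/
lemma exists_range_le_ker_le (h : (rhoA ψ).rank ≤ (rhoAB ψ).rank) :
    ∃ (R : Submodule ℂ (EuclideanSpace ℂ (Fin a))) (K : Submodule ℂ (Fin c → ℂ)),
      (∀ f, LinearMap.range (slices ψ f) ≤ R) ∧ ⨅ f, LinearMap.ker (slices ψ f) ≤ K ∧
      Module.finrank ℂ R + Module.finrank ℂ K ≤ Module.finrank ℂ (Fin c → ℂ) := by
  rw [rhoA_eq_mul_conjTranspose, rhoAB_eq_mul_conjTranspose,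
    Matrix.rank_self_mul_conjTranspose, Matrix.rank_self_mul_conjTranspose] at h
  let L := (WithLp.linearEquiv 2 ℂ (Fin a → ℂ)).symm
  refine ⟨(LinearMap.range (flattenA ψ).mulVecLin).map L.toLinearMap,
    LinearMap.ker (flattenAB ψ).mulVecLin, ?_, ?_, ?_⟩
  · rintro f _ ⟨x, rfl⟩
    refine ⟨_, ⟨fun p => f p.1 * x p.2, rfl⟩, ?_⟩
    ext i
    change (flattenA ψ *ᵥ fun p => f p.1 * x p.2) i = _
    simp only [Matrix.of_apply, slices_apply, Matrix.mulVec, dotProduct, flattenA,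
      Fintype.sum_prod_type, Finset.mul_sum]
    exact Finset.sum_congr rfl fun j _ => Finset.sum_congr rfl fun k _ => by ring
  · intro x hx
    rw [LinearMap.mem_ker, Matrix.mulVecLin_apply]
    ext p
    have := LinearMap.mem_ker.mp ((Submodule.mem_iInf _).mp hx (Pi.single p.2 1))
    have := congrArg (fun v : EuclideanSpace ℂ (Fin a) => v p.1) this
    simpa [slices_apply, Pi.single_apply, Matrix.mulVec, dotProduct, flattenAB] using this
  · have h1 : Module.finrank ℂ ((LinearMap.range (flattenA ψ).mulVecLin).map L.toLinearMap) =
        (flattenA ψ).rank :=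
      LinearEquiv.finrank_map_eq L _
    have h2 : (flattenAB ψ).rank + _ = _ :=
      LinearMap.finrank_range_add_finrank_ker (flattenAB ψ).mulVecLin
    have h3 := h1.trans_le h
    linarith

end Tripartite

/-- if ρ_BC is PPT and the eigenvalue vectors of ρ_A and ρ_AB
majorize each other, then ρ_BC is separable. -/
theorem env_separable_of_mutual_majorization {a b c : ℕ}
    (ψ : Fin a × Fin b × Fin c → ℂ) (hψ : UnitVec ψ)
    (hppt : (ptransB (rhoBC ψ)).PosSemidef)
    (hA : (rhoA ψ).IsHermitian) (hAB : (rhoAB ψ).IsHermitian)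
    (h1 : Majorizes hA.eigenvalues hAB.eigenvalues)
    (h2 : Majorizes hAB.eigenvalues hA.eigenvalues) :
    SeparableState (rhoBC ψ) := by
  have hpos : (rhoA ψ).PosSemidef := by
    rw [rhoA_eq_mul_conjTranspose]
    exact Matrix.posSemidef_self_mul_conjTranspose _
  have hrank : (rhoA ψ).rank ≤ (rhoAB ψ).rank := by
    rw [hA.rank_eq_card_non_zero_eigs, hAB.rank_eq_card_non_zero_eigs]
    exact h1.card_ne_zero_le hpos.eigenvalues_nonneg
  obtain ⟨R, K, hR, hK, hRK⟩ := exists_range_le_ker_le ψ hrank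
  obtain ⟨n, u, l, t, hu⟩ :=
    (pptSlices_slices ψ hppt).exists_orthonormalBasis_inner_eq R K hR hK hRK
  refine separableState_of_eq_sum_tens_projv (trace_rhoBC hψ)
    (fun i j => l i (Pi.single j 1)) (fun i k => t i (Pi.single k 1)) ?_
  ext p q
  rw [rhoBC_eq_inner, ← u.sum_inner_mul_inner, Matrix.sum_apply]
  refine Finset.sum_congr rfl fun i _ => ?_
  rw [← inner_conj_symm, hu, hu, map_mul]
  simp only [tens, projv]
  ring

end
end

section
/- If a tripartite pure state |Ψ⟩_ABC has both reduced states ρ_AB and ρ_AC separable, then up to local unitary operators |Ψ⟩ = Σ_i √p_i |b_i⟩|i⟩|i⟩, i.e., the reduced state ρ_BC is maximally correlated: ρ_BC = Σ_{i,j} c_{ij} |i⟩⟨j| ⊗ |i⟩⟨j| in some orthonormal product bases. -/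
open Matrix BigOperators
open scoped ComplexOrder

noncomputable section

/-- Spectral decomposition of a positive semidefinite complex matrix. -/
theorem Matrix.PosSemidef.exists_unitary_diagonal {n : Type*} [Fintype n] [DecidableEq n]
    {A : Matrix n n ℂ} (hA : A.PosSemidef) :
    ∃ (U : Matrix n n ℂ) (l : n → ℝ), (∀ i, 0 ≤ l i) ∧ Uᴴ * U = 1 ∧
      A = U * diagonal (fun i => (l i : ℂ)) * Uᴴ := by
  refine ⟨hA.1.eigenvectorUnitary, hA.1.eigenvalues, hA.eigenvalues_nonneg, ?_, ?_⟩
  · exact Unitary.coe_star_mul_self hA.1.eigenvectorUnitary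
  · conv_lhs => rw [hA.1.spectral_theorem, Unitary.conjStarAlgAut_apply]
    rfl

theorem Matrix.PosSemidef.exists_eq_conjTranspose_mul_self {n : Type*} [Fintype n]
    {A : Matrix n n ℂ} (hA : A.PosSemidef) : ∃ X : Matrix n n ℂ, A = Xᴴ * X := by
  classical
  obtain ⟨U, l, hl, -, rfl⟩ := hA.exists_unitary_diagonal
  refine ⟨diagonal (fun i => (Real.sqrt (l i) : ℂ)) * Uᴴ, ?_⟩
  have hd : (diagonal (fun i => (Real.sqrt (l i) : ℂ)))ᴴ * diagonal (fun i => (Real.sqrt (l i) : ℂ))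
      = diagonal (fun i => (l i : ℂ)) := by
    rw [diagonal_conjTranspose, diagonal_mul_diagonal]
    congr 1
    ext i
    simp only [Pi.star_apply, Complex.star_def, Complex.conj_ofReal]
    rw [← Complex.ofReal_mul, Real.mul_self_sqrt (hl i)]
  rw [conjTranspose_mul, conjTranspose_conjTranspose, ← hd]
  simp only [Matrix.mul_assoc]

/-- The trace of a product of positive semidefinite matrices is that of a Gram matrix. -/
theorem Matrix.PosSemidef.exists_trace_mul_eq {n : Type*} [Fintype n] {A B : Matrix n n ℂ}
    (hA : A.PosSemidef) (hB : B.PosSemidef) :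
    ∃ Z : Matrix n n ℂ, (A * B).trace = (Zᴴ * Z).trace ∧ (Z = 0 → A * B = 0) := by
  obtain ⟨X, rfl⟩ := hA.exists_eq_conjTranspose_mul_self
  obtain ⟨Y, rfl⟩ := hB.exists_eq_conjTranspose_mul_self
  refine ⟨X * Yᴴ, ?_, fun h => ?_⟩
  · rw [conjTranspose_mul, conjTranspose_conjTranspose, ← Matrix.mul_assoc, trace_mul_comm]
    simp only [Matrix.mul_assoc]
  · rw [Matrix.mul_assoc, ← Matrix.mul_assoc X, h, Matrix.zero_mul, Matrix.mul_zero]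

theorem Matrix.PosSemidef.trace_mul_nonneg {n : Type*} [Fintype n] {A B : Matrix n n ℂ}
    (hA : A.PosSemidef) (hB : B.PosSemidef) : 0 ≤ (A * B).trace := by
  obtain ⟨Z, hZ, -⟩ := hA.exists_trace_mul_eq hB
  rw [hZ]
  exact (posSemidef_conjTranspose_mul_self Z).trace_nonneg

theorem Matrix.PosSemidef.mul_eq_zero_of_trace {n : Type*} [Fintype n] {A B : Matrix n n ℂ}
    (hA : A.PosSemidef) (hB : B.PosSemidef) (h : (A * B).trace.re = 0) : A * B = 0 := by
  obtain ⟨Z, hZ, hZ0⟩ := hA.exists_trace_mul_eq hB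
  refine hZ0 (trace_conjTranspose_mul_self_eq_zero_iff.1 ?_)
  rw [← hZ]
  exact Complex.ext h (Complex.nonneg_iff.1 (hA.trace_mul_nonneg hB)).2.symm

theorem IsDensity.exists_spectrum {n : Type*} [Fintype n] [DecidableEq n] {A : Matrix n n ℂ}
    (hA : IsDensity A) :
    ∃ (U : Matrix n n ℂ) (l : n → ℝ), (∀ i, 0 ≤ l i) ∧ Uᴴ * U = 1 ∧
      A = U * diagonal (fun i => (l i : ℂ)) * Uᴴ ∧ ∑ i, l i = 1 ∧
      (A * A).trace.re = ∑ i, l i ^ 2 := by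
  obtain ⟨U, l, hl, hU, h⟩ := hA.1.exists_unitary_diagonal
  refine ⟨U, l, hl, hU, h, ?_, ?_⟩
  · have h1 := hA.2
    rw [h, trace_mul_comm, ← Matrix.mul_assoc, hU, Matrix.one_mul, trace_diagonal] at h1
    exact_mod_cast h1
  · have h2 : A * A = U * (diagonal (fun i => (l i : ℂ)) * diagonal (fun i => (l i : ℂ))) * Uᴴ := by
      calc A * A = U * diagonal (fun i => (l i : ℂ)) * (Uᴴ * U) *
            diagonal (fun i => (l i : ℂ)) * Uᴴ := by rw [h]; simp only [Matrix.mul_assoc]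
        _ = _ := by rw [hU]; simp only [Matrix.mul_assoc, Matrix.one_mul]
    rw [h2, trace_mul_comm, ← Matrix.mul_assoc, hU, Matrix.one_mul, diagonal_mul_diagonal,
      trace_diagonal, Complex.re_sum]
    refine Finset.sum_congr rfl fun i _ => ?_
    rw [← Complex.ofReal_mul, Complex.ofReal_re, sq]

theorem IsDensity.trace_sq_le {n : Type*} [Fintype n] {A : Matrix n n ℂ} (hA : IsDensity A) :
    (A * A).trace.re ≤ 1 := by
  classical
  obtain ⟨U, l, hl, -, -, hsum, htr⟩ := hA.exists_spectrum
  rw [htr, ← hsum]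
  refine Finset.sum_le_sum fun i hi => ?_
  have : l i ≤ 1 := hsum ▸ Finset.single_le_sum (fun j _ => hl j) hi
  nlinarith [hl i]

theorem IsDensity.trace_sq_ne_zero {n : Type*} [Fintype n] {A : Matrix n n ℂ} (hA : IsDensity A) :
    (A * A).trace.re ≠ 0 := by
  classical
  intro h0
  obtain ⟨U, l, hl, -, -, hsum, htr⟩ := hA.exists_spectrum
  rw [htr, Finset.sum_eq_zero_iff_of_nonneg (fun i _ => sq_nonneg _)] at h0
  rw [Finset.sum_eq_zero fun i hi => pow_eq_zero_iff two_ne_zero |>.1 (h0 i hi)] at hsum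
  exact zero_ne_one hsum

/-- A density matrix of purity one is a rank-one projection onto a unit vector. -/
theorem IsDensity.exists_eq_projv {n : Type*} [Fintype n] {A : Matrix n n ℂ} (hA : IsDensity A)
    (h : (A * A).trace.re = 1) : ∃ v : n → ℂ, UnitVec v ∧ A = projv v := by
  classical
  obtain ⟨U, l, hl, hU, hAU, hsum, htr⟩ := hA.exists_spectrum
  have hle : ∀ i, l i ≤ 1 := fun i =>
    hsum ▸ Finset.single_le_sum (fun j _ => hl j) (Finset.mem_univ i)
  have hz : ∀ i ∈ Finset.univ, l i - l i ^ 2 = 0 := by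
    refine (Finset.sum_eq_zero_iff_of_nonneg fun i _ => ?_).1 ?_
    · nlinarith [hl i, hle i]
    · rw [Finset.sum_sub_distrib, hsum, ← htr, h, sub_self]
  obtain ⟨i, hi⟩ : ∃ i, l i ≠ 0 := by
    by_contra! hc
    simp [hc] at hsum
  have hi1 : l i = 1 := by
    have := hz i (Finset.mem_univ i)
    exact mul_left_cancel₀ hi (by linarith)
  have hj : ∀ j, j ≠ i → l j = 0 := by
    have := Finset.add_sum_erase Finset.univ l (Finset.mem_univ i)
    rw [hsum, hi1, add_eq_left, Finset.sum_eq_zero_iff_of_nonneg fun j _ => hl j] at this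
    exact fun j hj => this j (Finset.mem_erase.2 ⟨hj, Finset.mem_univ j⟩)
  refine ⟨fun x => U x i, ?_, ?_⟩
  · have := congr_fun₂ hU i i
    rw [mul_apply, one_apply_eq] at this
    have h2 : ((∑ x, Complex.normSq (U x i) : ℝ) : ℂ) = 1 := by
      rw [← this, Complex.ofReal_sum]
      refine Finset.sum_congr rfl fun x _ => ?_
      rw [conjTranspose_apply, Complex.star_def, Complex.normSq_eq_conj_mul_self]
    exact_mod_cast h2
  · ext x y
    rw [hAU, mul_apply, Finset.sum_eq_single i]
    · simp [mul_diagonal, projv, hi1]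
    · intro j _ hji
      simp [mul_diagonal, hj j hji]
    · simp

theorem IsDensity.trace_sub_sq_nonneg {n : Type*} [Fintype n] {A B : Matrix n n ℂ}
    (hA : IsDensity A) (hB : IsDensity B) :
    0 ≤ ((A - B) * (A - B)).trace.re ∧
      (((A - B) * (A - B)).trace.re = 0 → A = B) ∧
      ((A - B) * (A - B)).trace.re
        = (A * A).trace.re + (B * B).trace.re - 2 * (A * B).trace.re := by
  have hh : (A - B)ᴴ = A - B := by rw [conjTranspose_sub, hA.1.1.eq, hB.1.1.eq]
  have hn := (posSemidef_conjTranspose_mul_self (A - B)).trace_nonneg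
  rw [hh] at hn
  refine ⟨(Complex.nonneg_iff.1 hn).1, fun h => ?_, ?_⟩
  · rw [← sub_eq_zero, ← trace_conjTranspose_mul_self_eq_zero_iff, hh]
    exact Complex.ext h (Complex.nonneg_iff.1 hn).2.symm
  · rw [Matrix.sub_mul, Matrix.mul_sub, Matrix.mul_sub]
    simp only [trace_sub, Complex.sub_re, trace_mul_comm B A]
    ring

theorem IsDensity.trace_mul_le {n : Type*} [Fintype n] {A B : Matrix n n ℂ}
    (hA : IsDensity A) (hB : IsDensity B) : (A * B).trace.re ≤ 1 := by
  have h := hA.trace_sub_sq_nonneg hB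
  linarith [h.1, h.2.2, hA.trace_sq_le, hB.trace_sq_le]

theorem IsDensity.eq_of_trace_mul_eq_one {n : Type*} [Fintype n] {A B : Matrix n n ℂ}
    (hA : IsDensity A) (hB : IsDensity B) (h1 : (A * B).trace.re = 1) : A = B := by
  have h := hA.trace_sub_sq_nonneg hB
  exact h.2.1 (le_antisymm (by linarith [h.2.2, hA.trace_sq_le, hB.trace_sq_le]) h.1)

/-- A Schmidt-type decomposition: an eigendecomposition of `Ψ * Ψᴴ` lifts to one of `Ψ`. -/
theorem exists_schmidt {m γ ι : Type*} [Fintype m] [Fintype γ] [Fintype ι] [DecidableEq m]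
    [DecidableEq ι]
    (Ψ : Matrix m γ ℂ) (W : Matrix m ι ℂ) (l : ι → ℝ) (hl : ∀ i, 0 < l i) (hW : Wᴴ * W = 1)
    (h : Ψ * Ψᴴ = W * diagonal (fun i => (l i : ℂ)) * Wᴴ) :
    ∃ F : Matrix γ ι ℂ, Fᴴ * F = 1 ∧
      Ψ = W * diagonal (fun i => (Real.sqrt (l i) : ℂ)) * Fᴴ := by
  have hs : ∀ i, (Real.sqrt (l i) : ℂ) ≠ 0 := fun i =>
    Complex.ofReal_ne_zero.2 (Real.sqrt_pos.2 (hl i)).ne'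
  have hP : W * Wᴴ * Ψ = Ψ := by
    have h0 : (1 - W * Wᴴ) * (Ψ * Ψᴴ) = 0 := by
      calc (1 - W * Wᴴ) * (Ψ * Ψᴴ)
          = (W - W * (Wᴴ * W)) * diagonal (fun i => (l i : ℂ)) * Wᴴ := by
            rw [h]; simp only [Matrix.sub_mul, Matrix.mul_assoc, Matrix.one_mul]
        _ = 0 := by rw [hW]; simp
    rw [mul_self_mul_conjTranspose_eq_zero, Matrix.sub_mul, Matrix.one_mul, sub_eq_zero] at h0
    exact h0.symm
  set S := diagonal (fun i => (Real.sqrt (l i) : ℂ)) with hS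
  set T := diagonal (fun i => (Real.sqrt (l i) : ℂ)⁻¹) with hT
  have hTh : Tᴴ = T := by
    rw [hT, diagonal_conjTranspose]
    congr 1
    ext i
    simp
  have hST : S * T = 1 := by
    rw [hS, hT, diagonal_mul_diagonal, ← diagonal_one]
    congr 1
    ext i
    exact mul_inv_cancel₀ (hs i)
  have hTlT : T * diagonal (fun i => (l i : ℂ)) * T = 1 := by
    rw [hT, diagonal_mul_diagonal, diagonal_mul_diagonal, ← diagonal_one]
    congr 1
    ext i
    have : (l i : ℂ) = Real.sqrt (l i) * Real.sqrt (l i) := by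
      rw [← Complex.ofReal_mul, Real.mul_self_sqrt (hl i).le]
    rw [this]
    field_simp [hs i]
  refine ⟨Ψᴴ * W * T, ?_, ?_⟩
  · calc (Ψᴴ * W * T)ᴴ * (Ψᴴ * W * T) = T * Wᴴ * (Ψ * Ψᴴ) * W * T := by
          simp only [conjTranspose_mul, hTh, conjTranspose_conjTranspose, Matrix.mul_assoc]
      _ = T * (Wᴴ * W) * diagonal (fun i => (l i : ℂ)) * (Wᴴ * W) * T := by
          rw [h]; simp only [Matrix.mul_assoc]
      _ = 1 := by rw [hW, Matrix.mul_one, Matrix.mul_one, hTlT]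
  · calc Ψ = W * (1 : Matrix ι ι ℂ) * Wᴴ * Ψ := by rw [Matrix.mul_one, hP]
      _ = _ := by
        rw [← hST]
        simp only [conjTranspose_mul, hTh, conjTranspose_conjTranspose, Matrix.mul_assoc]

theorem Matrix.PosSemidef.ofReal_re_trace_mul {n : Type*} [Fintype n] {A B : Matrix n n ℂ}
    (hA : A.PosSemidef) (hB : B.PosSemidef) : (((A * B).trace.re : ℝ) : ℂ) = (A * B).trace :=
  Complex.ext (Complex.ofReal_re _)
    ((Complex.ofReal_im _).trans (Complex.nonneg_iff.1 (hA.trace_mul_nonneg hB)).2)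

theorem tens_mul_tens {α β : Type*} [Fintype α] [Fintype β] (A A' : Matrix α α ℂ)
    (B B' : Matrix β β ℂ) : tens A B * tens A' B' = tens (A * A') (B * B') :=
  (mul_kronecker_mul A A' B B').symm

theorem trace_tens_s10 {α β : Type*} [Fintype α] [Fintype β] (A : Matrix α α ℂ)
    (B : Matrix β β ℂ) : (tens A B).trace = A.trace * B.trace :=
  trace_kronecker A B

/-- A tripartite vector viewed as a matrix from `C` to `AB`. -/
def matAB {α β γ : Type*} (ψ : α × β × γ → ℂ) : Matrix (α × β) γ ℂ :=
  fun m z => ψ (m.1, m.2, z)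

theorem rhoAB_eq {α β γ : Type*} [Fintype γ] (ψ : α × β × γ → ℂ) :
    rhoAB ψ = matAB ψ * (matAB ψ)ᴴ := rfl

theorem rhoC_eq {α β γ : Type*} [Fintype α] [Fintype β] (ψ : α × β × γ → ℂ) :
    rhoC ψ = ((matAB ψ)ᴴ * matAB ψ)ᵀ := by
  ext x y
  simp only [rhoC, transpose_apply, mul_apply, conjTranspose_apply, matAB, Fintype.sum_prod_type,
    Complex.star_def]
  exact Finset.sum_congr rfl fun _ _ => Finset.sum_congr rfl fun _ _ => mul_comm _ _

theorem rhoB_eq {α β γ : Type*} [Fintype α] [Fintype γ] (ψ : α × β × γ → ℂ) :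
    rhoB ψ = ptrA (rhoAB ψ) := rfl

theorem trace_rhoAB_sq {α β γ : Type*} [Fintype α] [Fintype β] [Fintype γ]
    (ψ : α × β × γ → ℂ) : (rhoAB ψ * rhoAB ψ).trace = (rhoC ψ * rhoC ψ).trace := by
  rw [rhoAB_eq, rhoC_eq, ← transpose_mul, trace_transpose, Matrix.mul_assoc, trace_mul_comm]
  simp only [Matrix.mul_assoc]

theorem trace_rhoAB {α β γ : Type*} [Fintype α] [Fintype β] [Fintype γ]
    {ψ : α × β × γ → ℂ} (hψ : UnitVec ψ) : (rhoAB ψ).trace = 1 := by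
  have h : ((∑ x, Complex.normSq (ψ x) : ℝ) : ℂ) = 1 := by rw [hψ]; simp
  rw [← h]
  simp only [trace, diag_apply, rhoAB, Fintype.sum_prod_type, Complex.ofReal_sum, Complex.mul_conj]

theorem sum_eq_sum_subtype {ι R : Type*} [Fintype ι] [AddCommMonoid R] (P : ι → Prop)
    [DecidablePred P] (f : ι → R) (h : ∀ i, ¬P i → f i = 0) :
    ∑ i, f i = ∑ i : {i // P i}, f i := by
  rw [← Finset.sum_subtype (Finset.univ.filter P) (by simp) f]
  exact (Finset.sum_filter_of_ne fun i _ hi => not_not.1 (mt (h i) hi)).symm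

section SeparableDecomposition

variable {α β : Type*} [Fintype α] {k : ℕ} {p : Fin k → ℝ}
  {σ : Fin k → Matrix α α ℂ} {τ : Fin k → Matrix β β ℂ}

theorem ptrA_sum_tens (hσ : ∀ i, IsDensity (σ i)) :
    ptrA (∑ i, (p i : ℂ) • tens (σ i) (τ i)) = ∑ i, (p i : ℂ) • τ i := by
  ext x y
  simp only [ptrA, Matrix.sum_apply, Matrix.smul_apply, tens, smul_eq_mul]
  rw [Finset.sum_comm]
  refine Finset.sum_congr rfl fun i _ => ?_
  have h : ∑ u, σ i u u = 1 := (hσ i).2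
  rw [← Finset.mul_sum, ← Finset.sum_mul, h, one_mul]

variable [Fintype β]

theorem trace_sq_sum_tens (hσ : ∀ i, IsDensity (σ i)) (hτ : ∀ i, IsDensity (τ i)) :
    ((∑ i, (p i : ℂ) • tens (σ i) (τ i)) * ∑ i, (p i : ℂ) • tens (σ i) (τ i)).trace.re
      = ∑ i, ∑ j, p i * p j * ((σ i * σ j).trace.re * (τ i * τ j).trace.re) := by
  simp only [Finset.sum_mul, Finset.mul_sum, trace_sum, Complex.re_sum, Matrix.smul_mul,
    Matrix.mul_smul, trace_smul, tens_mul_tens, trace_tens_s10]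
  rw [Finset.sum_comm]
  refine Finset.sum_congr rfl fun i _ => Finset.sum_congr rfl fun j _ => ?_
  rw [← (hσ _).1.ofReal_re_trace_mul (hσ _).1, ← (hτ _).1.ofReal_re_trace_mul (hτ _).1]
  simp only [smul_eq_mul, ← Complex.ofReal_mul, Complex.ofReal_re]
  ring

theorem trace_sq_sum_smul (hτ : ∀ i, IsDensity (τ i)) :
    ((∑ i, (p i : ℂ) • τ i) * ∑ i, (p i : ℂ) • τ i).trace.re
      = ∑ i, ∑ j, p i * p j * (τ i * τ j).trace.re := by
  simp only [Finset.sum_mul, Finset.mul_sum, trace_sum, Complex.re_sum, Matrix.smul_mul,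
    Matrix.mul_smul, trace_smul]
  rw [Finset.sum_comm]
  refine Finset.sum_congr rfl fun i _ => Finset.sum_congr rfl fun j _ => ?_
  rw [← (hτ _).1.ofReal_re_trace_mul (hτ _).1]
  simp only [smul_eq_mul, ← Complex.ofReal_mul, Complex.ofReal_re]
  ring

theorem purity_term_le (hp : ∀ i, 0 ≤ p i) (hσ : ∀ i, IsDensity (σ i))
    (hτ : ∀ i, IsDensity (τ i)) (i j : Fin k) :
    p i * p j * ((σ i * σ j).trace.re * (τ i * τ j).trace.re)
      ≤ p i * p j * (τ i * τ j).trace.re :=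
  mul_le_mul_of_nonneg_left
    (mul_le_of_le_one_left (Complex.nonneg_iff.1 ((hτ i).1.trace_mul_nonneg (hτ j).1)).1
      ((hσ i).trace_mul_le (hσ j)))
    (mul_nonneg (hp i) (hp j))

/-- If a separable decomposition has the same purity as its second marginal, then any two of its
terms have either orthogonal second factors or equal pure first factors. -/
theorem trace_eq_zero_or_eq_one_of_purity_le (hp : ∀ i, 0 ≤ p i) (hσ : ∀ i, IsDensity (σ i))
    (hτ : ∀ i, IsDensity (τ i))
    (h : ∑ i, ∑ j, p i * p j * (τ i * τ j).trace.re
      ≤ ∑ i, ∑ j, p i * p j * ((σ i * σ j).trace.re * (τ i * τ j).trace.re))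
    {i j : Fin k} (hi : p i ≠ 0) (hj : p j ≠ 0) :
    (τ i * τ j).trace.re = 0 ∨ (σ i * σ j).trace.re = 1 := by
  have hle := purity_term_le hp hσ hτ
  have h1 := (Finset.sum_eq_sum_iff_of_le fun i _ => Finset.sum_le_sum fun j _ => hle i j).1
    (le_antisymm (Finset.sum_le_sum fun i _ => Finset.sum_le_sum fun j _ => hle i j) h)
    i (Finset.mem_univ i)
  have h2 := (Finset.sum_eq_sum_iff_of_le fun j _ => hle i j).1 h1 j (Finset.mem_univ j)
  have h3 := mul_left_cancel₀ (mul_ne_zero hi hj) h2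
  by_cases h0 : (τ i * τ j).trace.re = 0
  · exact Or.inl h0
  · exact Or.inr (mul_right_cancel₀ h0 (h3.trans (one_mul _).symm))

end SeparableDecomposition

/-- The purity of a separable state is at most that of its marginal. -/
theorem SeparableState.purity_le {α β γ : Type*} [Fintype α] [Fintype β] [Fintype γ]
    {ψ : α × β × γ → ℂ} (h : SeparableState (rhoAB ψ)) :
    (rhoC ψ * rhoC ψ).trace.re ≤ (rhoB ψ * rhoB ψ).trace.re := by
  obtain ⟨k, p, σ, τ, hp, -, hσ, hτ, hρ⟩ := h
  rw [← trace_rhoAB_sq, rhoB_eq, hρ, ptrA_sum_tens hσ, trace_sq_sum_tens hσ hτ,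
    trace_sq_sum_smul hτ]
  exact Finset.sum_le_sum fun i _ => Finset.sum_le_sum fun j _ => purity_term_le hp hσ hτ i j

/-- A separable state at least as pure as its marginal is a sum of products of rank-one
projections with mutually orthogonal positive operators. -/
theorem SeparableState.exists_orthogonal_blocks {α β γ : Type*} [Fintype α] [Fintype β]
    [Fintype γ] {ψ : α × β × γ → ℂ} (h : SeparableState (rhoAB ψ))
    (hpur : (rhoB ψ * rhoB ψ).trace.re ≤ (rhoC ψ * rhoC ψ).trace.re) :
    ∃ (κ : Type) (_ : Fintype κ) (v : κ → α → ℂ) (M : κ → Matrix β β ℂ),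
      (∀ q, UnitVec (v q)) ∧ (∀ q, (M q).PosSemidef) ∧ (∀ q r, q ≠ r → M q * M r = 0) ∧
      rhoAB ψ = ∑ q, tens (projv (v q)) (M q) := by
  classical
  obtain ⟨k, p, σ, τ, hp, -, hσ, hτ, hρ⟩ := h
  rw [← trace_rhoAB_sq, rhoB_eq, hρ, ptrA_sum_tens hσ, trace_sq_sum_tens hσ hτ,
    trace_sq_sum_smul hτ] at hpur
  have key := fun i j (hi : p i ≠ 0) (hj : p j ≠ 0) =>
    trace_eq_zero_or_eq_one_of_purity_le hp hσ hτ hpur hi hj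
  let J := {i : Fin k // p i ≠ 0}
  let s : Setoid J := Setoid.ker fun j => σ j.1
  have hv : ∀ q : Quotient s, ∃ v : α → ℂ, UnitVec v ∧ σ q.out.1 = projv v := fun q =>
    (hσ _).exists_eq_projv
      ((key _ _ q.out.2 q.out.2).resolve_left (hτ _).trace_sq_ne_zero)
  choose v hv hσv using hv
  refine ⟨Quotient s, inferInstance, v,
    fun q => ∑ j : J with Quotient.mk s j = q, (p j.1 : ℂ) • τ j.1, hv, fun q => ?_,
    fun q r hqr => ?_, ?_⟩
  · refine posSemidef_sum _ fun j _ => (hτ j.1).1.smul ?_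
    exact_mod_cast hp j.1
  · rw [Finset.sum_mul]
    refine Finset.sum_eq_zero fun i hi => ?_
    rw [Finset.mul_sum]
    refine Finset.sum_eq_zero fun j hj => ?_
    rw [Finset.mem_filter] at hi hj
    rw [Matrix.smul_mul, Matrix.mul_smul, (hτ i.1).1.mul_eq_zero_of_trace (hτ j.1).1, smul_zero,
      smul_zero]
    refine (key i.1 j.1 i.2 j.2).resolve_right fun h1 => hqr ?_
    rw [← hi.2, ← hj.2]
    exact Quotient.sound ((hσ i.1).eq_of_trace_mul_eq_one (hσ j.1) h1)
  · ext x y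
    rw [hρ, Matrix.sum_apply, Matrix.sum_apply,
      sum_eq_sum_subtype (fun i => p i ≠ 0) _ fun i hi => by simp [not_not.1 hi],
      ← Finset.sum_fiberwise Finset.univ (Quotient.mk s)]
    refine Finset.sum_congr rfl fun q _ => ?_
    simp only [tens, Matrix.smul_apply, Matrix.sum_apply, smul_eq_mul, Finset.mul_sum]
    refine Finset.sum_congr rfl fun j hj => ?_
    have h1 : σ q.out.1 = σ j.1 :=
      Quotient.exact (q.out_eq.trans (Finset.mem_filter.1 hj).2.symm)
    rw [← hσv, h1]
    ring

/-- Orthogonal positive blocks have a joint orthonormal family of eigenvectors with positive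
eigenvalues. -/
theorem exists_orthonormal_eigenvectors {κ β : Type} [Fintype κ] [Fintype β]
    (M : κ → Matrix β β ℂ) (hM : ∀ q, (M q).PosSemidef) (horth : ∀ q r, q ≠ r → M q * M r = 0) :
    ∃ (ι : Type) (_ : Fintype ι) (_ : DecidableEq ι) (g : ι → κ) (l : ι → ℝ) (E : Matrix β ι ℂ),
      (∀ i, 0 < l i) ∧ Eᴴ * E = 1 ∧
      ∀ (a : κ → ℂ) x y, ∑ q, a q * M q x y
        = ∑ i, a (g i) * (l i * (E x i * (starRingEnd ℂ) (E y i))) := by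
  classical
  choose U l hl hU hMU using fun q => (hM q).exists_unitary_diagonal
  let P : κ × β → Prop := fun m => l m.1 m.2 ≠ 0
  refine ⟨{m // P m}, inferInstance, inferInstance, fun m => m.1.1, fun m => l m.1.1 m.1.2,
    of fun y m => U m.1.1 y m.1.2, fun m => lt_of_le_of_ne (hl _ _) (Ne.symm m.2), ?_, ?_⟩
  · ext ⟨⟨q, s⟩, hs⟩ ⟨⟨r, t⟩, ht⟩
    have hmul : ((of fun y m => U m.1.1 y m.1.2 : Matrix β {m // P m} ℂ)ᴴ *
        (of fun y m => U m.1.1 y m.1.2 : Matrix β {m // P m} ℂ)) ⟨⟨q, s⟩, hs⟩ ⟨⟨r, t⟩, ht⟩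
        = ((U q)ᴴ * U r) s t := rfl
    rw [hmul]
    by_cases hqr : q = r
    · subst hqr
      rw [hU, one_apply, one_apply]
      simp
    · rw [one_apply_ne (by simp [hqr])]
      have h0 : diagonal (fun i => (l q i : ℂ)) * ((U q)ᴴ * U r) * diagonal (fun i => (l r i : ℂ))
          = 0 := by
        calc diagonal (fun i => (l q i : ℂ)) * ((U q)ᴴ * U r) * diagonal (fun i => (l r i : ℂ))
            = ((U q)ᴴ * U q) * diagonal (fun i => (l q i : ℂ)) * ((U q)ᴴ * U r) *
                diagonal (fun i => (l r i : ℂ)) * ((U r)ᴴ * U r) := by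
              rw [hU, hU, Matrix.one_mul, Matrix.mul_one]
          _ = (U q)ᴴ * (M q * M r) * U r := by
              rw [hMU q, hMU r]; simp only [Matrix.mul_assoc]
          _ = 0 := by rw [horth q r hqr, Matrix.mul_zero, Matrix.zero_mul]
      have h1 := congr_fun₂ h0 s t
      rw [mul_diagonal, diagonal_mul, Matrix.zero_apply] at h1
      have hs' : (l q s : ℂ) ≠ 0 := Complex.ofReal_ne_zero.2 hs
      have ht' : (l r t : ℂ) ≠ 0 := Complex.ofReal_ne_zero.2 ht
      simpa [hs', ht'] using h1
  · intro a x y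
    refine Eq.trans ?_ (sum_eq_sum_subtype P (fun m => a m.1 * ((l m.1 m.2 : ℂ) *
      (U m.1 x m.2 * (starRingEnd ℂ) (U m.1 y m.2)))) fun m hm => by simp [not_not.1 hm])
    rw [Fintype.sum_prod_type]
    refine Finset.sum_congr rfl fun q _ => ?_
    conv_lhs => rw [hMU q]
    rw [mul_apply, Finset.mul_sum]
    refine Finset.sum_congr rfl fun s _ => ?_
    rw [mul_diagonal, conjTranspose_apply, Complex.star_def]
    ring

theorem UnitVec.sum_conj_mul {α : Type*} [Fintype α] {v : α → ℂ} (hv : UnitVec v) :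
    ∑ x, (starRingEnd ℂ) (v x) * v x = 1 := by
  have h : ((∑ x, Complex.normSq (v x) : ℝ) : ℂ) = 1 := by rw [hv]; simp
  rw [← h, Complex.ofReal_sum]
  exact Finset.sum_congr rfl fun x _ => Complex.normSq_eq_conj_mul_self.symm

/-- Separability of both reductions gives a generalized Schmidt decomposition. -/
theorem exists_generalized_schmidt {α β γ : Type} [Fintype α] [Fintype β] [Fintype γ]
    {ψ : α × β × γ → ℂ} (h1 : SeparableState (rhoAB ψ)) (h2 : SeparableState (rhoAC ψ))
    (hψ : UnitVec ψ) :
    ∃ (ι : Type) (_ : Fintype ι) (_ : DecidableEq ι) (l : ι → ℝ) (v : ι → α → ℂ)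
      (E : Matrix β ι ℂ) (F : Matrix γ ι ℂ),
      (∀ i, 0 < l i) ∧ ∑ i, l i = 1 ∧ (∀ i, UnitVec (v i)) ∧ Eᴴ * E = 1 ∧ Fᴴ * F = 1 ∧
      ∀ x, ψ x = ∑ i, (Real.sqrt (l i) : ℂ) * v i x.1 * E x.2.1 i
        * (starRingEnd ℂ) (F x.2.2 i) := by
  classical
  have hC : SeparableState (rhoAB fun x : α × γ × β => ψ (x.1, x.2.2, x.2.1)) := h2
  have hpur : (rhoB ψ * rhoB ψ).trace.re ≤ (rhoC ψ * rhoC ψ).trace.re := hC.purity_le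
  obtain ⟨κ, _, v, M, hv, hM, horth, hρ⟩ := h1.exists_orthogonal_blocks hpur
  obtain ⟨ι, _, _, g, l, E, hl, hE, hsum⟩ := exists_orthonormal_eigenvectors M hM horth
  let W : Matrix (α × β) ι ℂ := of fun m i => v (g i) m.1 * E m.2 i
  have hWa : ∀ m i, W m i = v (g i) m.1 * E m.2 i := fun _ _ => rfl
  have hW : Wᴴ * W = 1 := by
    ext i j
    have h : (Wᴴ * W) i j
        = (∑ x, (starRingEnd ℂ) (v (g i) x) * v (g j) x) * (Eᴴ * E) i j := by
      simp only [mul_apply, conjTranspose_apply, Complex.star_def, Finset.sum_mul_sum,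
        Fintype.sum_prod_type, hWa, map_mul]
      exact Finset.sum_congr rfl fun _ _ => Finset.sum_congr rfl fun _ _ => by ring
    rw [h, hE]
    by_cases hij : i = j
    · subst hij
      rw [(hv _).sum_conj_mul, one_mul]
    · rw [one_apply_ne hij, mul_zero]
  have hΨ : matAB ψ * (matAB ψ)ᴴ = W * diagonal (fun i => (l i : ℂ)) * Wᴴ := by
    rw [← rhoAB_eq, hρ]
    ext x y
    rw [Matrix.sum_apply]
    simp only [tens]
    rw [hsum (fun q => projv (v q) x.1 y.1), mul_apply]
    refine Finset.sum_congr rfl fun i _ => ?_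
    simp only [mul_diagonal, conjTranspose_apply, Complex.star_def, hWa, map_mul, projv]
    ring
  obtain ⟨F, hF, hΨF⟩ := exists_schmidt (matAB ψ) W l hl hW hΨ
  refine ⟨ι, inferInstance, inferInstance, l, fun i => v (g i), E, F, hl, ?_, fun i => hv _, hE,
    hF, fun x => ?_⟩
  · have ht := trace_rhoAB hψ
    rw [rhoAB_eq, hΨ, trace_mul_comm, ← Matrix.mul_assoc, hW, Matrix.one_mul, trace_diagonal] at ht
    exact_mod_cast ht
  · change matAB ψ (x.1, x.2.1) x.2.2 = _
    rw [hΨF, mul_apply]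
    refine Finset.sum_congr rfl fun i _ => ?_
    simp only [mul_diagonal, conjTranspose_apply, Complex.star_def, hWa]
    ring

/-- A generalized Schmidt decomposition makes the reduced state on `BC` maximally correlated. -/
theorem isMaxCorrelated_rhoBC {α β γ : Type*} [Fintype α] [Fintype β] [Fintype γ] {k : ℕ}
    {ψ : α × β × γ → ℂ} (w : Fin k → α → ℂ) {e : Fin k → β → ℂ} {f : Fin k → γ → ℂ}
    (he : OrthonormalFam e) (hf : OrthonormalFam f)
    (h : ∀ x, ψ x = ∑ i, w i x.1 * e i x.2.1 * f i x.2.2) : IsMaxCorrelated (rhoBC ψ) := by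
  refine ⟨k, fun i j => ∑ x, w i x * (starRingEnd ℂ) (w j x), e, f, he, hf, fun s t => ?_⟩
  simp only [rhoBC, h, map_sum, Finset.sum_mul_sum, map_mul]
  rw [Finset.sum_comm]
  refine Finset.sum_congr rfl fun i _ => ?_
  rw [Finset.sum_comm]
  refine Finset.sum_congr rfl fun j _ => ?_
  rw [Finset.sum_mul, Finset.sum_mul]
  exact Finset.sum_congr rfl fun x _ => by ring

/-- if ρ_AB and ρ_AC are both separable, then up to local
unitaries |Ψ⟩ = Σ_i √p_i |b_i⟩|i⟩|i⟩, i.e. ρ_BC is maximally correlated. -/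
theorem max_correlated_of_two_separable {a b c : ℕ}
    (ψ : Fin a × Fin b × Fin c → ℂ) (hψ : UnitVec ψ)
    (h1 : SeparableState (rhoAB ψ)) (h2 : SeparableState (rhoAC ψ)) :
    (∃ (k : ℕ) (p : Fin k → ℝ) (v : Fin k → Fin a → ℂ)
       (e : Fin k → Fin b → ℂ) (f : Fin k → Fin c → ℂ),
      (∀ i, 0 ≤ p i) ∧ ∑ i, p i = 1 ∧ (∀ i, UnitVec (v i)) ∧
      OrthonormalFam e ∧ OrthonormalFam f ∧
      ∀ x, ψ x = ∑ i, (Real.sqrt (p i) : ℂ) * v i x.1 * e i x.2.1 * f i x.2.2) ∧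
    IsMaxCorrelated (rhoBC ψ) := by
  obtain ⟨ι, _, _, l, v, E, F, hl, hsum, hv, hE, hF, hx⟩ := exists_generalized_schmidt h1 h2 hψ
  let g := (Fintype.equivFin ι).symm
  have he : OrthonormalFam fun i y => E y (g i) := fun i j => by
    have h := congr_fun₂ hE (g i) (g j)
    simpa [mul_apply, one_apply] using h
  have hf : OrthonormalFam fun i z => (starRingEnd ℂ) (F z (g i)) := fun i j => by
    have h := congr_fun₂ hF (g j) (g i)
    simpa [mul_apply, one_apply, mul_comm, eq_comm] using h
  have hx' : ∀ x, ψ x = ∑ i, (Real.sqrt (l (g i)) : ℂ) * v (g i) x.1 * E x.2.1 (g i)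
      * (starRingEnd ℂ) (F x.2.2 (g i)) := fun x =>
    (hx x).trans (g.sum_comp fun i => (Real.sqrt (l i) : ℂ) * v i x.1 * E x.2.1 i
      * (starRingEnd ℂ) (F x.2.2 i)).symm
  exact ⟨⟨_, fun i => l (g i), fun i => v (g i), _, _, fun i => (hl _).le,
    (g.sum_comp l).trans hsum, fun i => hv _, he, hf, hx'⟩,
    isMaxCorrelated_rhoBC (fun i x => Real.sqrt (l (g i)) * v (g i) x) he hf hx'⟩

end
end
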